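/- arXiv:1703.06127 — 2 statements merged into one kernel-verified Lean document; each statement's English description precedes it below -/
import Mathlib

section
/- For every dimension d ≥ 1 there exists a constant c_d > 0 (depending only on d) such that for every integer N ≥ 2 and every Borel probability measure μ on [0,1]^d there exist points x_1, ..., x_N ∈ [0,1]^d whose star-discrepancy with respect to μ satisfies D_N*(x_1, ..., x_N; μ) ≤ c_d (log N)^{d - 1/2} / N. -/
open MeasureTheory ProbabilityTheory
open scoped ENNReal Pointwise RealInnerProductSpace

/-- The one-dimensional Brunn–Minkowski inequality. -/
theorem volume_add_volume_le_of_add_subset {A B C : Set ℝ} (hA : MeasurableSet A)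
    (hB : MeasurableSet B) (hA' : A.Nonempty) (hB' : B.Nonempty)
    (h : ∀ a ∈ A, ∀ b ∈ B, a + b ∈ C) : volume A + volume B ≤ volume C := by
  obtain ⟨a₀, ha₀⟩ := hA'
  obtain ⟨b₀, hb₀⟩ := hB'
  have key : ∀ K ⊆ A, IsCompact K → ∀ K' ⊆ B, IsCompact K' → volume K + volume K' ≤ volume C := by
    intro K hK hKc K' hK' hKc'
    obtain rfl | hKn := K.eq_empty_or_nonempty
    · rw [measure_empty, zero_add, ← measure_preimage_add volume (-a₀) K']
      refine measure_mono fun x hx => ?_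
      have := h a₀ ha₀ _ (hK' hx)
      simpa using this
    obtain rfl | hKn' := K'.eq_empty_or_nonempty
    · rw [measure_empty, add_zero, ← measure_preimage_add volume (-b₀) K]
      refine measure_mono fun x hx => ?_
      have := h _ (hK hx) b₀ hb₀
      simpa using this
    obtain ⟨M, hM, hMmax⟩ := hKc.exists_isGreatest hKn
    obtain ⟨m, hm, hmmin⟩ := hKc'.exists_isLeast hKn'
    have h1 : volume ((fun x => -m + x) ⁻¹' K) = volume K := measure_preimage_add volume _ _
    have h2 : volume ((fun x => -M + x) ⁻¹' K') = volume K' := measure_preimage_add volume _ _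
    have h3 : ((fun x => -m + x) ⁻¹' K) ∩ ((fun x => -M + x) ⁻¹' K') ⊆ {m + M} := by
      rintro x ⟨hx1, hx2⟩
      have a1 := hMmax hx1
      have a2 := hmmin hx2
      simp only [Set.mem_singleton_iff]
      linarith
    have h4 : volume (((fun x => -m + x) ⁻¹' K) ∩ ((fun x => -M + x) ⁻¹' K')) = 0 :=
      measure_mono_null h3 (by simp)
    have hmeas : MeasurableSet ((fun x => -M + x) ⁻¹' K') :=
      (measurable_const_add (-M)) hKc'.measurableSet
    rw [← h1, ← h2, ← measure_union_add_inter _ hmeas, h4, add_zero]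
    refine measure_mono ?_
    rintro x (hx | hx)
    · have := h _ (hK hx) _ (hK' hm)
      simpa using this
    · have := h _ (hK hM) _ (hK' hx)
      simpa using this
  rw [hA.measure_eq_iSup_isCompact, hB.measure_eq_iSup_isCompact]
  simp only [iSup_and']
  exact ENNReal.biSup_add_biSup_le' ⟨∅, by simp⟩ ⟨∅, by simp⟩
    fun K hK K' hK' => key K hK.1 hK.2 K' hK'.1 hK'.2

theorem lintegral_add_lintegral_le_of_normalized {p q : ℝ} (hp : 0 < p) (hq : 0 < q)
    {f g h : ℝ → ℝ} (hf : Measurable f) (hg : Measurable g)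
    (hh : Measurable h) (hf0 : ∀ x, 0 ≤ f x) (hg0 : ∀ x, 0 ≤ g x) (hh0 : ∀ x, 0 ≤ h x)
    (hf1 : ∀ x, f x ≤ 1) (hg1 : ∀ x, g x ≤ 1) (hfs : ∀ t < 1, ∃ x, t < f x)
    (hgs : ∀ t < 1, ∃ x, t < g x) (hpq : p + q = 1)
    (H : ∀ x y, f x ^ p * g y ^ q ≤ h (p * x + q * y)) :
    ENNReal.ofReal p * (∫⁻ x, ENNReal.ofReal (f x))
      + ENNReal.ofReal q * (∫⁻ x, ENNReal.ofReal (g x)) ≤ ∫⁻ x, ENNReal.ofReal (h x) := by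
  have mono : ∀ {k : ℝ → ℝ}, Measurable k → Measurable fun t => volume {a | t < k a} := by
    intro k _
    exact Antitone.measurable fun s t hst => measure_mono fun x (hx : t < k x) => hst.trans_lt hx
  rw [lintegral_eq_lintegral_meas_lt _ (.of_forall hf0) hf.aemeasurable,
    lintegral_eq_lintegral_meas_lt _ (.of_forall hg0) hg.aemeasurable,
    lintegral_eq_lintegral_meas_lt _ (.of_forall hh0) hh.aemeasurable,
    ← lintegral_const_mul _ (mono hf), ← lintegral_const_mul _ (mono hg),
    ← lintegral_add_left ((mono hf).const_mul _)]
  refine setLIntegral_mono (mono hh) fun t (ht : 0 < t) => ?_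
  rcases lt_or_ge t 1 with ht1 | ht1
  · have e1 : ∀ (c : ℝ) (_ : 0 < c) (k : ℝ → ℝ), ENNReal.ofReal c * volume {a | t < k a}
        = volume ((fun x => c⁻¹ * x) ⁻¹' {a | t < k a}) := by
      intro c hc k
      rw [Real.volume_preimage_mul_left (inv_ne_zero hc.ne'), inv_inv, abs_of_pos hc]
    rw [e1 p hp, e1 q hq]
    refine volume_add_volume_le_of_add_subset ?_ ?_ ?_ ?_ ?_
    · exact (measurable_const_mul _) (measurableSet_lt measurable_const hf)
    · exact (measurable_const_mul _) (measurableSet_lt measurable_const hg)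
    · obtain ⟨x, hx⟩ := hfs t ht1
      exact ⟨p * x, by simpa [hp.ne'] using hx⟩
    · obtain ⟨x, hx⟩ := hgs t ht1
      exact ⟨q * x, by simpa [hq.ne'] using hx⟩
    · intro a ha b hb
      simp only [Set.mem_preimage, Set.mem_ofPred_eq] at ha hb ⊢
      have := H (p⁻¹ * a) (q⁻¹ * b)
      rw [mul_inv_cancel_left₀ hp.ne', mul_inv_cancel_left₀ hq.ne'] at this
      refine lt_of_lt_of_le ?_ this
      calc t = t ^ p * t ^ q := by rw [← Real.rpow_add ht, hpq, Real.rpow_one]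
        _ < _ := mul_lt_mul'' (Real.rpow_lt_rpow ht.le ha hp) (Real.rpow_lt_rpow ht.le hb hq)
          (by positivity) (by positivity)
  · have z : ∀ k : ℝ → ℝ, (∀ x, k x ≤ 1) → volume {a | t < k a} = 0 := by
      intro k hk
      have : {a | t < k a} = ∅ := by
        ext x
        simpa using (hk x).trans ht1
      rw [this, measure_empty]
    rw [z f hf1, z g hg1]
    simp

/-- A measure satisfies the Prékopa–Leindler inequality (restricted to functions bounded by one). -/
def PrekopaLeindler {E : Type*} [AddCommGroup E] [Module ℝ E] [MeasurableSpace E]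
    (μ : Measure E) : Prop :=
  ∀ p q : ℝ, 0 < p → 0 < q → p + q = 1 → ∀ f g h : E → ℝ≥0∞,
    Measurable f → Measurable g → Measurable h → (∀ x, f x ≤ 1) → (∀ x, g x ≤ 1) →
    (∀ x y, f x ^ p * g y ^ q ≤ h (p • x + q • y)) →
    (∫⁻ x, f x ∂μ) ^ p * (∫⁻ x, g x ∂μ) ^ q ≤ ∫⁻ x, h x ∂μ

theorem ENNReal.rpow_mul_rpow_le_add {p q : ℝ} (hp : 0 < p) (hq : 0 < q) (hpq : p + q = 1)
    (a b : ℝ≥0∞) : a ^ p * b ^ q ≤ ENNReal.ofReal p * a + ENNReal.ofReal q * b := by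
  rcases eq_or_ne a ∞ with rfl | ha
  · rw [ENNReal.mul_top (by simpa using hp)]
    simp
  rcases eq_or_ne b ∞ with rfl | hb
  · rw [ENNReal.mul_top (by simpa using hq)]
    simp
  lift a to NNReal using ha
  lift b to NNReal using hb
  have := Real.geom_mean_le_arith_mean2_weighted hp.le hq.le a.coe_nonneg b.coe_nonneg hpq
  have h2 := ENNReal.ofReal_le_ofReal this
  rwa [ENNReal.ofReal_mul (by positivity), ENNReal.ofReal_add (by positivity) (by positivity),
    ENNReal.ofReal_mul hp.le, ENNReal.ofReal_mul hq.le,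
    ← ENNReal.ofReal_rpow_of_nonneg a.coe_nonneg hp.le, ← ENNReal.ofReal_rpow_of_nonneg b.coe_nonneg hq.le,
    ENNReal.ofReal_coe_nnreal, ENNReal.ofReal_coe_nnreal] at h2

theorem prekopaLeindler_volume_real : PrekopaLeindler (volume : Measure ℝ) := by
  intro p q hp hq hpq f g h hf hg hh hf1 hg1 H
  set A := ⨆ x, f x with hA
  set B := ⨆ x, g x with hB
  have hA1 : A ≤ 1 := iSup_le hf1
  have hB1 : B ≤ 1 := iSup_le hg1
  have hfA : ∀ x, f x ≤ A := le_iSup f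
  have hgB : ∀ x, g x ≤ B := le_iSup g
  rcases eq_or_ne A 0 with hA0 | hA0
  · have : ∀ x, f x = 0 := fun x => le_antisymm ((hfA x).trans_eq hA0) bot_le
    simp [this, hp]
  rcases eq_or_ne B 0 with hB0 | hB0
  · have : ∀ x, g x = 0 := fun x => le_antisymm ((hgB x).trans_eq hB0) bot_le
    simp [this, hq]
  have hAt : A ≠ ∞ := (hA1.trans_lt ENNReal.one_lt_top).ne
  have hBt : B ≠ ∞ := (hB1.trans_lt ENNReal.one_lt_top).ne
  set D := A ^ p * B ^ q with hD
  have hD0 : D ≠ 0 := by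
    simp only [hD, ne_eq, mul_eq_zero, ENNReal.rpow_eq_zero_iff, not_or]
    refine ⟨?_, ?_⟩ <;> simp [hA0, hB0, hAt, hBt]
  have hDt : D ≠ ∞ := by
    refine ENNReal.mul_ne_top ?_ ?_ <;> exact ENNReal.rpow_ne_top_of_nonneg (by positivity) ‹_›
  set h' : ℝ → ℝ≥0∞ := fun x => min (h x) D with hh'
  have hh't : ∀ x, h' x / D ≠ ∞ := fun x =>
    ENNReal.div_ne_top ((min_le_right _ _).trans_lt hDt.lt_top).ne hD0
  have hfAt : ∀ x, f x / A ≠ ∞ := fun x => ENNReal.div_ne_top ((hf1 x).trans_lt (by simp)).ne hA0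
  have hgBt : ∀ x, g x / B ≠ ∞ := fun x => ENNReal.div_ne_top ((hg1 x).trans_lt (by simp)).ne hB0
  have H' : ∀ x y, (f x / A) ^ p * (g y / B) ^ q ≤ h' (p * x + q * y) / D := by
    intro x y
    rw [ENNReal.div_rpow_of_nonneg _ _ hp.le, ENNReal.div_rpow_of_nonneg _ _ hq.le]
    rw [ENNReal.le_div_iff_mul_le (Or.inl hD0) (Or.inl hDt)]
    have : f x ^ p / A ^ p * (g y ^ q / B ^ q) * D = f x ^ p * g y ^ q := by
      have e1 : f x ^ p / A ^ p * A ^ p = f x ^ p :=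
        ENNReal.div_mul_cancel (by simp [ENNReal.rpow_eq_zero_iff, hA0, hAt])
          (ENNReal.rpow_ne_top_of_nonneg hp.le hAt)
      have e2 : g y ^ q / B ^ q * B ^ q = g y ^ q :=
        ENNReal.div_mul_cancel (by simp [ENNReal.rpow_eq_zero_iff, hB0, hBt])
          (ENNReal.rpow_ne_top_of_nonneg hq.le hBt)
      calc _ = (f x ^ p / A ^ p * A ^ p) * (g y ^ q / B ^ q * B ^ q) := by rw [hD]; ring
        _ = _ := by rw [e1, e2]
    rw [this]
    refine le_min (H x y) ?_
    exact mul_le_mul' (ENNReal.rpow_le_rpow (hfA x) hp.le) (ENNReal.rpow_le_rpow (hgB y) hq.le)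
  have sup_aux : ∀ {k : ℝ → ℝ≥0∞} {S : ℝ≥0∞}, S = ⨆ x, k x → S ≠ 0 → S ≠ ∞ →
      (∀ x, k x / S ≠ ∞) → ∀ t < (1 : ℝ), ∃ x, t < (k x / S).toReal := by
    intro k S hS hS0 hSt hkS t ht
    rcases lt_or_ge t 0 with ht0 | ht0
    · exact ⟨0, ht0.trans_le ENNReal.toReal_nonneg⟩
    have : ENNReal.ofReal t * S < ⨆ x, k x := by
      rw [← hS]
      calc ENNReal.ofReal t * S < 1 * S :=
            ENNReal.mul_lt_mul_left hS0 hSt (by simpa using ht)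
        _ = S := one_mul _
    obtain ⟨x, hx⟩ := lt_iSup_iff.1 this
    refine ⟨x, ?_⟩
    rw [← ENNReal.ofReal_lt_iff_lt_toReal ht0 (hkS x)]
    rwa [ENNReal.lt_div_iff_mul_lt (Or.inl hS0) (Or.inl hSt)]
  have key := lintegral_add_lintegral_le_of_normalized hp hq
    (f := fun x => (f x / A).toReal) (g := fun x => (g x / B).toReal)
    (h := fun x => (h' x / D).toReal)
    (hf.div_const A).ennreal_toReal (hg.div_const B).ennreal_toReal
    ((hh.min measurable_const).div_const D).ennreal_toReal (fun _ => ENNReal.toReal_nonneg)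
    (fun _ => ENNReal.toReal_nonneg) (fun _ => ENNReal.toReal_nonneg)
    (fun x => ENNReal.toReal_le_of_le_ofReal zero_le_one
      (by simpa using ENNReal.div_le_of_le_mul (by simpa using hfA x)))
    (fun x => ENNReal.toReal_le_of_le_ofReal zero_le_one
      (by simpa using ENNReal.div_le_of_le_mul (by simpa using hgB x)))
    (sup_aux hA hA0 hAt hfAt) (sup_aux hB hB0 hBt hgBt) hpq
    (fun x y => by
      rw [ENNReal.toReal_rpow, ENNReal.toReal_rpow, ← ENNReal.toReal_mul]
      exact ENNReal.toReal_mono (hh't _) (H' x y))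
  simp only [ENNReal.ofReal_toReal (hfAt _), ENNReal.ofReal_toReal (hgBt _),
    ENNReal.ofReal_toReal (hh't _)] at key
  simp only [div_eq_mul_inv] at key
  rw [lintegral_mul_const _ hf, lintegral_mul_const _ hg,
    lintegral_mul_const _ (hh.min measurable_const)] at key
  have key2 := (ENNReal.rpow_mul_rpow_le_add hp hq hpq _ _).trans key
  rw [← div_eq_mul_inv, ← div_eq_mul_inv, ← div_eq_mul_inv,
    ENNReal.le_div_iff_mul_le (Or.inl hD0) (Or.inl hDt), hD, mul_mul_mul_comm,
    ← ENNReal.mul_rpow_of_nonneg _ _ hp.le, ← ENNReal.mul_rpow_of_nonneg _ _ hq.le,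
    ENNReal.div_mul_cancel hA0 hAt, ENNReal.div_mul_cancel hB0 hBt] at key2
  exact key2.trans (lintegral_mono fun x => min_le_left _ _)

theorem PrekopaLeindler.withDensity {E : Type*} [AddCommGroup E] [Module ℝ E] [MeasurableSpace E]
    {μ : Measure E} (hμ : PrekopaLeindler μ) {w : E → ℝ≥0∞} (hw : Measurable w)
    (hw1 : ∀ x, w x ≤ 1)
    (H : ∀ p q : ℝ, 0 < p → 0 < q → p + q = 1 → ∀ x y, w x ^ p * w y ^ q ≤ w (p • x + q • y)) :
    PrekopaLeindler (μ.withDensity w) := by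
  intro p q hp hq hpq f g h hf hg hh hf1 hg1 H'
  rw [lintegral_withDensity_eq_lintegral_mul _ hw hf, lintegral_withDensity_eq_lintegral_mul _ hw hg,
    lintegral_withDensity_eq_lintegral_mul _ hw hh]
  refine hμ p q hp hq hpq _ _ _ (hw.mul hf) (hw.mul hg) (hw.mul hh)
    (fun x => mul_le_one' (hw1 x) (hf1 x)) (fun x => mul_le_one' (hw1 x) (hg1 x)) fun x y => ?_
  simp only [Pi.mul_apply]
  rw [ENNReal.mul_rpow_of_nonneg _ _ hp.le, ENNReal.mul_rpow_of_nonneg _ _ hq.le,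
    mul_mul_mul_comm]
  exact mul_le_mul' (H p q hp hq hpq x y) (H' x y)

theorem PrekopaLeindler.prod {E F : Type*} [AddCommGroup E] [Module ℝ E] [MeasurableSpace E]
    [AddCommGroup F] [Module ℝ F] [MeasurableSpace F] {μ : Measure E} {ν : Measure F}
    [IsProbabilityMeasure ν] (hμ : PrekopaLeindler μ) (hν : PrekopaLeindler ν) :
    PrekopaLeindler (μ.prod ν) := by
  intro p q hp hq hpq f g h hf hg hh hf1 hg1 H
  rw [lintegral_prod _ hf.aemeasurable, lintegral_prod _ hg.aemeasurable,
    lintegral_prod _ hh.aemeasurable]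
  refine hμ p q hp hq hpq _ _ _ hf.lintegral_prod_right' hg.lintegral_prod_right'
    hh.lintegral_prod_right' (fun x => ?_) (fun x => ?_) fun x y => ?_
  · exact (lintegral_mono fun y => hf1 _).trans (by simp)
  · exact (lintegral_mono fun y => hg1 _).trans (by simp)
  · exact hν p q hp hq hpq _ _ _ (hf.comp measurable_prodMk_left) (hg.comp measurable_prodMk_left)
      (hh.comp measurable_prodMk_left) (fun _ => hf1 _) (fun _ => hg1 _) fun a b => H _ _

theorem PrekopaLeindler.map {E F : Type*} [AddCommGroup E] [Module ℝ E] [MeasurableSpace E]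
    [AddCommGroup F] [Module ℝ F] [MeasurableSpace F] {μ : Measure E} (hμ : PrekopaLeindler μ)
    (T : E →ₗ[ℝ] F) (hT : Measurable T) : PrekopaLeindler (μ.map T) := by
  intro p q hp hq hpq f g h hf hg hh hf1 hg1 H
  rw [lintegral_map hf hT, lintegral_map hg hT, lintegral_map hh hT]
  refine hμ p q hp hq hpq _ _ _ (hf.comp hT) (hg.comp hT) (hh.comp hT) (fun _ => hf1 _)
    (fun _ => hg1 _) fun x y => ?_
  simpa using H (T x) (T y)

theorem prekopaLeindler_gaussianReal : PrekopaLeindler (gaussianReal 0 1) := by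
  rw [gaussianReal_of_var_ne_zero 0 one_ne_zero]
  refine prekopaLeindler_volume_real.withDensity (measurable_gaussianPDF 0 1) (fun x => ?_) ?_
  · rw [gaussianPDF, gaussianPDFReal]
    refine ENNReal.ofReal_le_one.2 (mul_le_one₀ (inv_le_one_of_one_le₀ ?_) (by positivity) ?_)
    · rw [Real.one_le_sqrt]
      have := Real.pi_gt_three
      simp only [NNReal.coe_one]
      linarith
    · rw [Real.exp_le_one_iff]
      have := sq_nonneg (x - 0)
      simp only [NNReal.coe_one]
      linarith
  · intro p q hp hq hpq x y
    simp only [gaussianPDF]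
    rw [ENNReal.ofReal_rpow_of_nonneg (gaussianPDFReal_nonneg _ _ _) hp.le,
      ENNReal.ofReal_rpow_of_nonneg (gaussianPDFReal_nonneg _ _ _) hq.le,
      ← ENNReal.ofReal_mul (by have := gaussianPDFReal_nonneg 0 1 x; positivity)]
    refine ENNReal.ofReal_le_ofReal ?_
    simp only [gaussianPDFReal, NNReal.coe_one]
    rw [Real.mul_rpow (by positivity) (by positivity), Real.mul_rpow (by positivity) (by positivity),
      mul_mul_mul_comm, ← Real.rpow_add (by positivity), hpq, Real.rpow_one, ← Real.exp_mul,
      ← Real.exp_mul, ← Real.exp_add]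
    refine mul_le_mul_of_nonneg_left (Real.exp_le_exp.2 ?_) (by positivity)
    obtain rfl : q = 1 - p := by linarith
    simp only [smul_eq_mul]
    nlinarith [mul_nonneg (mul_nonneg hp.le hq.le) (sq_nonneg (x - y))]

theorem prekopaLeindler_pi_gaussianReal (n : ℕ) :
    PrekopaLeindler (Measure.pi fun _ : Fin n => gaussianReal 0 1) := by
  induction n with
  | zero =>
    intro p q hp hq hpq f g h hf hg hh hf1 hg1 H
    rw [Measure.pi_of_empty _ 0]
    simp only [lintegral_dirac]
    convert H 0 0
  | succ n ih =>
    have e := measurePreserving_piFinSuccAbove (fun _ : Fin (n + 1) => gaussianReal 0 1) 0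
    have e' := e.symm
    have hcons : ⇑(MeasurableEquiv.piFinSuccAbove (fun _ : Fin (n + 1) => ℝ) 0).symm
        = (Fin.consLinearEquiv ℝ (fun _ : Fin (n + 1) => ℝ)).toLinearMap := by
      ext z i
      exact congrFun (Fin.insertNth_zero' z.1 z.2) i
    rw [← e'.map_eq, hcons]
    exact (prekopaLeindler_gaussianReal.prod ih).map _ (hcons ▸ e'.measurable)

theorem OrdConnected.add_mem_or_sub_mem {I : Set ℝ} (hI : I.OrdConnected) {a h t z : ℝ}
    (ha : a ∈ I) (ha' : a + 2 * h ∈ I) (hz : z ∈ I) (htz : |t - z| ≤ h) :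
    t + h ∈ I ∨ t - h ∈ I := by
  rw [abs_le] at htz
  by_cases hc : a < t - h
  · exact Or.inr (hI.out ha hz ⟨hc.le, by linarith⟩)
  · exact Or.inl (hI.out hz ha' ⟨by linarith, by linarith⟩)

theorem gaussianReal_le_ofReal_mul_volume {S : Set ℝ} {M : ℝ}
    (h : ∀ x ∈ S, gaussianPDFReal 0 1 x ≤ M) :
    gaussianReal 0 1 S ≤ ENNReal.ofReal M * volume S := by
  rw [gaussianReal_apply 0 one_ne_zero, ← setLIntegral_const]
  exact setLIntegral_mono measurable_const fun x hx => ENNReal.ofReal_le_ofReal (h x hx)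

theorem ofReal_mul_volume_le_gaussianReal {S : Set ℝ} {M : ℝ}
    (h : ∀ x ∈ S, M ≤ gaussianPDFReal 0 1 x) :
    ENNReal.ofReal M * volume S ≤ gaussianReal 0 1 S := by
  rw [gaussianReal_apply 0 one_ne_zero, ← setLIntegral_const]
  exact setLIntegral_mono (measurable_gaussianPDF 0 1) fun x hx => ENNReal.ofReal_le_ofReal (h x hx)

theorem gaussianPDFReal_zero_one (x : ℝ) :
    gaussianPDFReal 0 1 x = (√(2 * Real.pi))⁻¹ * Real.exp (-x ^ 2 / 2) := by
  simp [gaussianPDFReal]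

theorem gaussianReal_le_of_forall_sub_le {I : Set ℝ}
    (h : ∀ x ∈ I, ∀ y ∈ I, y - x ≤ 1) : gaussianReal 0 1 I ≤ ENNReal.ofReal (2 / 5) := by
  have hv : volume I ≤ 1 := by
    refine (Real.volume_le_diam I).trans ?_
    refine Metric.ediam_le fun x hx y hy => ?_
    rw [edist_dist, Real.dist_eq, ← ENNReal.ofReal_one]
    exact ENNReal.ofReal_le_ofReal (abs_le.2 ⟨by linarith [h x hx y hy], h y hy x hx⟩)
  refine (gaussianReal_le_ofReal_mul_volume (M := 2 / 5) fun x _ => ?_).trans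
    (mul_le_of_le_one_right' hv)
  rw [gaussianPDFReal_zero_one]
  have h1 : Real.exp (-x ^ 2 / 2) ≤ 1 := Real.exp_le_one_iff.2 (by nlinarith [sq_nonneg x])
  have h2 : (5 / 2 : ℝ) ≤ √(2 * Real.pi) :=
    Real.le_sqrt_of_sq_le (by nlinarith [Real.pi_gt_d4])
  have h3 : (√(2 * Real.pi))⁻¹ ≤ 2 / 5 := by
    rw [show (2 / 5 : ℝ) = (5 / 2)⁻¹ by norm_num]
    exact inv_anti₀ (by norm_num) h2
  calc _ ≤ 2 / 5 * 1 := mul_le_mul h3 h1 (by positivity) (by norm_num)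
    _ = 2 / 5 := by norm_num

theorem exists_disjoint_gaussianReal_ge_aux {I : Set ℝ} {h l : ℝ} (hh : 0 < h)
    (hh2 : h ≤ 1 / 2) (hl1 : l ≤ 1) (hd : ∀ x ∈ I, ∀ y ∈ I, y - x ≤ l) (hn : I.Nonempty)
    (hpos : 0 ≤ sInf I + sSup I) (hl : 0 < l) :
    ∃ P, MeasurableSet P ∧ Disjoint P I ∧ (∀ x ∈ P, ∃ z ∈ I, |x - z| ≤ h) ∧
      ENNReal.ofReal (h / (2 * l)) * gaussianReal 0 1 I ≤ gaussianReal 0 1 P := by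
  obtain ⟨z₀, hz₀⟩ := hn
  have hbb : BddBelow I := ⟨z₀ - l, fun x hx => by linarith [hd x hx z₀ hz₀]⟩
  have hba : BddAbove I := ⟨z₀ + l, fun x hx => by linarith [hd z₀ hz₀ x hx]⟩
  set a := sInf I
  set b := sSup I
  have hab : b - a ≤ l := by
    have : b ≤ a + l := csSup_le ⟨z₀, hz₀⟩ fun y hy => by
      have : y - l ≤ a := le_csInf ⟨z₀, hz₀⟩ fun x hx => by linarith [hd x hx y hy]
      linarith
    linarith
  have ha : ∀ x ∈ I, a ≤ x := fun x hx => csInf_le hbb hx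
  have hb : ∀ x ∈ I, x ≤ b := fun x hx => le_csSup hba hx
  refine ⟨Set.Ioo (a - h) a, measurableSet_Ioo, ?_, ?_, ?_⟩
  · rw [Set.disjoint_left]
    intro x hx hxI
    exact absurd (ha x hxI) (not_le.2 hx.2)
  · intro x hx
    obtain ⟨z, hz, hzx⟩ := exists_lt_of_csInf_lt ⟨z₀, hz₀⟩ (show a < x + h by linarith [hx.1])
    exact ⟨z, hz, abs_le.2 ⟨by linarith, by linarith [ha z hz, hx.2]⟩⟩
  set M := (√(2 * Real.pi))⁻¹ * Real.exp (-(max a 0) ^ 2 / 2) with hM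
  have hM0 : 0 ≤ M := by positivity
  have hvI : volume I ≤ ENNReal.ofReal l := by
    calc volume I ≤ volume (Set.Icc a b) := measure_mono fun x hx => ⟨ha x hx, hb x hx⟩
      _ = ENNReal.ofReal (b - a) := Real.volume_Icc
      _ ≤ _ := ENNReal.ofReal_le_ofReal hab
  have h1 : gaussianReal 0 1 I ≤ ENNReal.ofReal (M * l) := by
    rw [ENNReal.ofReal_mul hM0]
    refine (gaussianReal_le_ofReal_mul_volume (M := M) fun x hx => ?_).trans
      (mul_le_mul_right hvI _)
    rw [gaussianPDFReal_zero_one]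
    refine mul_le_mul_of_nonneg_left (Real.exp_le_exp.2 ?_) (by positivity)
    rcases le_total a 0 with h0 | h0
    · rw [max_eq_right h0]
      nlinarith [sq_nonneg x]
    · rw [max_eq_left h0]
      nlinarith [ha x hx]
  have h2 : ENNReal.ofReal (M / 2 * h) ≤ gaussianReal 0 1 (Set.Ioo (a - h) a) := by
    rw [ENNReal.ofReal_mul (by positivity)]
    have hv : ENNReal.ofReal h = volume (Set.Ioo (a - h) a) := by
      rw [Real.volume_Ioo]; congr 1; ring
    rw [hv]
    refine ofReal_mul_volume_le_gaussianReal fun x hx => ?_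
    rw [gaussianPDFReal_zero_one, hM, mul_div_assoc]
    refine mul_le_mul_of_nonneg_left ?_ (by positivity)
    have hhalf : (1 / 2 : ℝ) ≤ Real.exp (-1 / 2) := by
      have := Real.add_one_le_exp (-1 / 2 : ℝ)
      linarith
    have : Real.exp (-(max a 0) ^ 2 / 2) * Real.exp (-1 / 2) ≤ Real.exp (-x ^ 2 / 2) := by
      rw [← Real.exp_add, Real.exp_le_exp]
      obtain ⟨hx1, hx2⟩ := hx
      rcases le_total a 0 with h0 | h0
      · rw [max_eq_right h0]
        nlinarith
      · rw [max_eq_left h0]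
        rcases le_total 0 x with h00 | h00 <;> nlinarith
    nlinarith [Real.exp_pos (-(max a 0) ^ 2 / 2)]
  calc _ ≤ ENNReal.ofReal (h / (2 * l)) * ENNReal.ofReal (M * l) := mul_le_mul_right h1 _
    _ = ENNReal.ofReal (M / 2 * h) := by
      rw [← ENNReal.ofReal_mul (by positivity)]
      congr 1
      field_simp
    _ ≤ _ := h2

theorem exists_disjoint_gaussianReal_ge {I : Set ℝ} (hI : MeasurableSet I) {h l : ℝ} (hh : 0 < h)
    (hh2 : h ≤ 1 / 2) (hl : 0 < l) (hl1 : l ≤ 1) (hd : ∀ x ∈ I, ∀ y ∈ I, y - x ≤ l)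
    (hn : I.Nonempty) :
    ∃ P, MeasurableSet P ∧ Disjoint P I ∧ (∀ x ∈ P, ∃ z ∈ I, |x - z| ≤ h) ∧
      ENNReal.ofReal (h / (2 * l)) * gaussianReal 0 1 I ≤ gaussianReal 0 1 P := by
  rcases le_total 0 (sInf I + sSup I) with hpos | hneg
  · exact exists_disjoint_gaussianReal_ge_aux hh hh2 hl1 hd hn hpos hl
  have hsymm : ∀ S : Set ℝ, MeasurableSet S → gaussianReal 0 1 (-S) = gaussianReal 0 1 S := by
    intro S hS
    have := gaussianReal_map_neg (μ := 0) (v := 1)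
    conv_rhs => rw [← neg_zero (G := ℝ), ← this]
    rw [Measure.map_apply measurable_neg hS]
    rfl
  obtain ⟨P, hP, hPd, hPI, hPg⟩ := exists_disjoint_gaussianReal_ge_aux (I := -I) hh hh2 hl1
    (fun x hx y hy => by
      have := hd (-y) hy (-x) hx
      linarith) hn.neg (by rw [Real.sInf_neg, Real.sSup_neg]; linarith) hl
  refine ⟨-P, hP.neg, ?_, ?_, ?_⟩
  · rw [Set.disjoint_left] at hPd ⊢
    intro x hx hxI
    exact hPd hx (by simpa using hxI)
  · intro x hx
    obtain ⟨z, hz, hzx⟩ := hPI _ hx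
    refine ⟨-z, hz, ?_⟩
    rw [← abs_neg]
    convert hzx using 2
    ring
  · rwa [hsymm P hP, ← hsymm I hI]

/-- Banaszczyk's operation: the part of `(K + u) ∪ (K - u)` lying on the lines parallel to `u`
which meet `K` in a set of length at least `2 ‖u‖`. -/
def spread {E : Type*} [AddCommGroup E] [Module ℝ E] (K : Set E) (u : E) : Set E :=
  {x | (∃ τ : ℝ, x + τ • u ∈ K ∧ x + (τ + 2) • u ∈ K) ∧ (x + u ∈ K ∨ x - u ∈ K)}

/-- The base points of the horizontal fibers of `K` that contain two points at distance `r`. -/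
def longFibers {F : Type*} (K : Set (ℝ × F)) (r : ℝ) : Set F :=
  {y | ∃ t, (t, y) ∈ K ∧ (t + r, y) ∈ K}

theorem IsOpen.spread {E : Type*} [NormedAddCommGroup E] [NormedSpace ℝ E] {K : Set E}
    (hK : IsOpen K) (u : E) : IsOpen (spread K u) := by
  have : _root_.spread K u = (⋃ τ : ℝ, {x | x + τ • u ∈ K} ∩ {x | x + (τ + 2) • u ∈ K}) ∩
      ({x | x + u ∈ K} ∪ {x | x - u ∈ K}) := by
    ext x
    simp [_root_.spread]
  rw [this]
  exact (isOpen_iUnion fun t => (hK.preimage (by fun_prop)).inter (hK.preimage (by fun_prop))).inter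
    ((hK.preimage (by fun_prop)).union (hK.preimage (by fun_prop)))

theorem IsOpen.longFibers {F : Type*} [TopologicalSpace F] {K : Set (ℝ × F)} (hK : IsOpen K) (r : ℝ) : IsOpen (longFibers K r) := by
  have : _root_.longFibers K r = ⋃ t : ℝ, {y | (t, y) ∈ K} ∩ {y | (t + r, y) ∈ K} := by
    ext y
    simp [_root_.longFibers]
  rw [this]
  exact isOpen_iUnion fun t => (hK.preimage (by fun_prop)).inter (hK.preimage (by fun_prop))

/-- The Gaussian mass of the fibers of `K` of length at least `r`. -/
noncomputable def longMass {F : Type*} [MeasurableSpace F] (ν : Measure F) (K : Set (ℝ × F)) (r : ℝ) : ℝ :=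
  ((gaussianReal 0 1).prod ν).real (K ∩ Prod.snd ⁻¹' longFibers K r)

theorem longMass_zero {F : Type*} [MeasurableSpace F] {ν : Measure F} {K : Set (ℝ × F)} :
    longMass ν K 0 = ((gaussianReal 0 1).prod ν).real K := by
  rw [longMass]
  congr 1
  refine Set.inter_eq_left.2 fun x hx => ⟨x.1, hx, ?_⟩
  simpa using hx

section Fibers

variable {F : Type*} [NormedAddCommGroup F] [NormedSpace ℝ F] {K : Set (ℝ × F)}

theorem Convex.ordConnected_fiber (hK : Convex ℝ K) (y : F) : {t | (t, y) ∈ K}.OrdConnected := by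
  have : Convex ℝ {t : ℝ | (t, y) ∈ K} := by
    intro s hs t ht a b ha hb hab
    have := hK hs ht ha hb hab
    simpa [← add_smul, hab] using this
  exact this.ordConnected

theorem longFibers_anti (hK : Convex ℝ K) {r s : ℝ} (hr : 0 ≤ r) (hrs : r ≤ s) :
    longFibers K s ⊆ longFibers K r := by
  rintro y ⟨t, h1, h2⟩
  exact ⟨t, h1, (hK.ordConnected_fiber y).out h1 h2 ⟨by linarith, by linarith⟩⟩

theorem fiber_sub_le (hK : Convex ℝ K) {r : ℝ} (hr : 0 ≤ r) {y : F} (hy : y ∉ longFibers K r)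
    {s t : ℝ} (hs : (s, y) ∈ K) (ht : (t, y) ∈ K) : t - s ≤ r := by
  by_contra! hc
  exact hy ⟨s, hs, (hK.ordConnected_fiber y).out hs ht ⟨by linarith, by linarith⟩⟩

theorem combo_mem_longFibers (hK : Convex ℝ K) {a b p q : ℝ} (hp : 0 ≤ p) (hq : 0 ≤ q)
    (hpq : p + q = 1) {y z : F} (hy : y ∈ longFibers K a) (hz : z ∈ longFibers K b) :
    p • y + q • z ∈ longFibers K (p * a + q * b) := by
  obtain ⟨s, h1, h2⟩ := hy
  obtain ⟨t, h3, h4⟩ := hz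
  refine ⟨p * s + q * t, ?_, ?_⟩
  · simpa using hK h1 h3 hp hq hpq
  · convert hK h2 h4 hp hq hpq using 1
    ext
    · simp
      ring
    · simp

theorem inter_longFibers_subset_spread (hK : Convex ℝ K) {h : ℝ} (hh : 0 < h) :
    K ∩ Prod.snd ⁻¹' longFibers K (2 * h) ⊆ spread K ((h, 0) : ℝ × F) := by
  rintro ⟨t, y⟩ ⟨ht, t₀, ht₀, ht₁⟩
  refine ⟨⟨(t₀ - t) / h, ?_, ?_⟩, ?_⟩
  · have : t + (t₀ - t) / h * h = t₀ := by field_simp; ring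
    simpa [this] using ht₀
  · have : t + ((t₀ - t) / h + 2) * h = t₀ + 2 * h := by field_simp; ring
    simpa [this] using ht₁
  · simpa using OrdConnected.add_mem_or_sub_mem (hK.ordConnected_fiber y) ht₀ ht₁ ht
      (by simpa using hh.le)

variable [MeasurableSpace F] {ν : Measure F} [IsProbabilityMeasure ν]

theorem longMass_anti (hK : Convex ℝ K) {r s : ℝ} (hr : 0 ≤ r) (hrs : r ≤ s) :
    longMass ν K s ≤ longMass ν K r :=
  measureReal_mono (Set.inter_subset_inter_right _ (Set.preimage_mono (longFibers_anti hK hr hrs)))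

variable [BorelSpace F] [SecondCountableTopology F]

theorem longMass_rpow_mul_le (hν : PrekopaLeindler ν) (hKo : IsOpen K) (hK : Convex ℝ K)
    {a b p q : ℝ} (hp : 0 ≤ p) (hq : 0 ≤ q) (hpq : p + q = 1) :
    longMass ν K a ^ p * longMass ν K b ^ q ≤ longMass ν K (p * a + q * b) := by
  rcases hp.eq_or_lt with rfl | hp
  · obtain rfl : q = 1 := by linarith
    simp
  rcases hq.eq_or_lt with rfl | hq
  · obtain rfl : p = 1 := by linarith
    simp
  have hm : ∀ r, MeasurableSet (K ∩ Prod.snd ⁻¹' longFibers K r) := fun r =>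
    hKo.measurableSet.inter (measurable_snd (hKo.longFibers r).measurableSet)
  have := prekopaLeindler_gaussianReal.prod hν p q hp hq hpq
    ((K ∩ Prod.snd ⁻¹' longFibers K a).indicator 1) ((K ∩ Prod.snd ⁻¹' longFibers K b).indicator 1)
    ((K ∩ Prod.snd ⁻¹' longFibers K (p * a + q * b)).indicator 1)
    (measurable_one.indicator (hm _)) (measurable_one.indicator (hm _))
    (measurable_one.indicator (hm _)) (fun x => Set.indicator_le_self' (by simp) x)
    (fun x => Set.indicator_le_self' (by simp) x) (fun x y => by
      by_cases hx : x ∈ K ∩ Prod.snd ⁻¹' longFibers K a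
      · by_cases hy : y ∈ K ∩ Prod.snd ⁻¹' longFibers K b
        · have : p • x + q • y ∈ K ∩ Prod.snd ⁻¹' longFibers K (p * a + q * b) :=
            ⟨hK hx.1 hy.1 hp.le hq.le hpq, combo_mem_longFibers hK hp.le hq.le hpq hx.2 hy.2⟩
          simp [Set.indicator_of_mem, hx, hy, this]
        · simp [Set.indicator_of_notMem hy, hq]
      · simp [Set.indicator_of_notMem hx, hp])
  rw [lintegral_indicator_one (hm _), lintegral_indicator_one (hm _),
    lintegral_indicator_one (hm _)] at this
  have h2 := ENNReal.toReal_mono (measure_ne_top _ _) this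
  rwa [ENNReal.toReal_mul, ← ENNReal.toReal_rpow, ← ENNReal.toReal_rpow] at h2

theorem longMass_mul_le (hν : PrekopaLeindler ν) (hKo : IsOpen K) (hK : Convex ℝ K) (r : ℝ)
    (j : ℕ) : longMass ν K 0 * longMass ν K ((j + 1 : ℕ) * r) ≤
      longMass ν K r * longMass ν K (j * r) := by
  have h0 : ∀ s, 0 ≤ longMass ν K s := fun s => measureReal_nonneg
  have hj : (0 : ℝ) < j + 1 := by positivity
  set p : ℝ := 1 / (j + 1) with hp
  set q : ℝ := j / (j + 1) with hq
  have hpq : p + q = 1 := by rw [hp, hq]; field_simp; ring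
  have hp0 : 0 ≤ p := by positivity
  have hq0 : 0 ≤ q := by positivity
  have h1 := longMass_rpow_mul_le hν hKo hK (a := (j + 1 : ℕ) * r) (b := 0) hp0 hq0 hpq
  have h2 := longMass_rpow_mul_le hν hKo hK (a := 0) (b := (j + 1 : ℕ) * r) hp0 hq0 hpq
  have e1 : p * ((j + 1 : ℕ) * r) + q * 0 = r := by rw [hp]; push_cast; field_simp; ring
  have e2 : p * 0 + q * ((j + 1 : ℕ) * r) = j * r := by rw [hq]; push_cast; field_simp; ring
  rw [e1] at h1
  rw [e2] at h2
  have hs : ∀ x : ℝ, 0 ≤ x → x ^ p * x ^ q = x := fun x hx => by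
    rw [← Real.rpow_add_of_nonneg hx hp0 hq0, hpq, Real.rpow_one]
  calc _ = (longMass ν K 0 ^ p * longMass ν K 0 ^ q) * (longMass ν K ((j + 1 : ℕ) * r) ^ p *
        longMass ν K ((j + 1 : ℕ) * r) ^ q) := by rw [hs _ (h0 _), hs _ (h0 _)]
    _ = (longMass ν K ((j + 1 : ℕ) * r) ^ p * longMass ν K 0 ^ q) *
        (longMass ν K 0 ^ p * longMass ν K ((j + 1 : ℕ) * r) ^ q) := by ring
    _ ≤ _ := mul_le_mul h1 h2 (by have := h0 0; have := h0 ((j + 1 : ℕ) * r); positivity) (h0 _)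

theorem longMass_one_ge (hKo : IsOpen K) (hK : Convex ℝ K)
    (hKm : 4 / 5 ≤ ((gaussianReal 0 1).prod ν).real K) :
    longMass ν K 0 / 2 ≤ longMass ν K 1 := by
  have hm : MeasurableSet (Prod.snd ⁻¹' longFibers K 1 : Set (ℝ × F)) :=
    measurable_snd (hKo.longFibers 1).measurableSet
  have h1 : ((gaussianReal 0 1).prod ν) (K \ Prod.snd ⁻¹' longFibers K 1)
      ≤ ENNReal.ofReal (2 / 5) := by
    rw [Measure.prod_apply_symm (hKo.measurableSet.diff hm)]
    calc _ ≤ ∫⁻ _ : F, ENNReal.ofReal (2 / 5) ∂ν := lintegral_mono fun y => by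
          refine gaussianReal_le_of_forall_sub_le fun s hs t ht => ?_
          exact fiber_sub_le hK zero_le_one hs.2 hs.1 ht.1
      _ = _ := by simp
  have h2 := ENNReal.toReal_le_of_le_ofReal (by norm_num) h1
  have h3 := measureReal_inter_add_sdiff (μ := (gaussianReal 0 1).prod ν) (s := K) hm
  rw [longMass_zero]
  simp only [longMass]
  rw [← measureReal_def] at h2
  linarith

theorem longMass_layer_le (hν : PrekopaLeindler ν) (hKo : IsOpen K) (hK : Convex ℝ K)
    (hKm : 4 / 5 ≤ ((gaussianReal 0 1).prod ν).real K) {r : ℝ} (hr : 0 ≤ r) {j : ℕ}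
    (hj : j * r ≤ 1) : (longMass ν K 0 - longMass ν K r) / 2 ≤
      longMass ν K (j * r) - longMass ν K ((j + 1 : ℕ) * r) := by
  have h0 : 0 < longMass ν K 0 := by rw [longMass_zero]; linarith
  have h1 := longMass_mul_le hν hKo hK r j
  have h2 : longMass ν K 0 / 2 ≤ longMass ν K (j * r) :=
    (longMass_one_ge hKo hK hKm).trans (longMass_anti hK (by positivity) hj)
  have h3 : longMass ν K r ≤ longMass ν K 0 := longMass_anti hK le_rfl hr
  refine le_of_mul_le_mul_left ?_ h0
  nlinarith [mul_nonneg (sub_nonneg.2 h3) (sub_nonneg.2 h2)]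

theorem spread_layer_ge (hKo : IsOpen K) (hK : Convex ℝ K) {h : ℝ} (hh : 0 < h) {j : ℕ}
    (hj1 : 1 ≤ j) (hj : 2 * (j + 1) * h ≤ 1) :
    1 / (4 * (j + 1)) * (longMass ν K (j * (2 * h)) - longMass ν K ((j + 1 : ℕ) * (2 * h))) ≤
      ((gaussianReal 0 1).prod ν).real ((spread K ((h, 0) : ℝ × F) \ K) ∩
        Prod.snd ⁻¹' (longFibers K (j * (2 * h)) \ longFibers K ((j + 1 : ℕ) * (2 * h)))) := by
  have hml : ∀ r, MeasurableSet (Prod.snd ⁻¹' longFibers K r : Set (ℝ × F)) := fun r =>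
    measurable_snd (hKo.longFibers r).measurableSet
  have hanti : longFibers K ((j + 1 : ℕ) * (2 * h)) ⊆ longFibers K (j * (2 * h)) :=
    longFibers_anti hK (by positivity) (by push_cast; nlinarith)
  set L := longFibers K (j * (2 * h)) \ longFibers K ((j + 1 : ℕ) * (2 * h)) with hL
  have hLm : MeasurableSet (Prod.snd ⁻¹' L : Set (ℝ × F)) := (hml _).diff (hml _)
  have e1 : longMass ν K (j * (2 * h)) - longMass ν K ((j + 1 : ℕ) * (2 * h)) =
      ((gaussianReal 0 1).prod ν).real (K ∩ Prod.snd ⁻¹' L) := by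
    rw [longMass, longMass, ← measureReal_sdiff
      (Set.inter_subset_inter_right _ (Set.preimage_mono hanti)) (hKo.measurableSet.inter (hml _))]
    congr 1
    ext x
    simp only [hL, Set.mem_sdiff, Set.mem_inter_iff, Set.mem_preimage]
    tauto
  have hj0 : (0 : ℝ) < j + 1 := by positivity
  have hj1' : (1 : ℝ) ≤ j := by exact_mod_cast hj1
  have hIm : ∀ y : F, MeasurableSet {t | (t, y) ∈ K} := fun y =>
    (hKo.preimage (f := fun t => (t, y)) (by fun_prop)).measurableSet
  have key : ENNReal.ofReal (1 / (4 * (j + 1))) *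
      ((gaussianReal 0 1).prod ν) (K ∩ Prod.snd ⁻¹' L) ≤
      ((gaussianReal 0 1).prod ν) ((spread K ((h, 0) : ℝ × F) \ K) ∩ Prod.snd ⁻¹' L) := by
    rw [Measure.prod_apply_symm (hKo.measurableSet.inter hLm), Measure.prod_apply_symm
      (((hKo.spread _).measurableSet.diff hKo.measurableSet).inter hLm),
      ← lintegral_const_mul _ (measurable_measure_prodMk_right (hKo.measurableSet.inter hLm))]
    refine lintegral_mono fun y => ?_
    by_cases hy : y ∈ L
    · have hle := fun s hs t ht => fiber_sub_le hK (y := y) (s := s) (t := t)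
        (by positivity) hy.2 hs ht
      obtain ⟨t₀, ht₀, ht₀'⟩ := hy.1
      obtain ⟨P, hP, hPd, hPI, hPg⟩ := exists_disjoint_gaussianReal_ge (hIm y) hh
        (by nlinarith) (l := (j + 1 : ℕ) * (2 * h)) (by positivity)
        (by push_cast; linarith) (fun s hs t ht => hle s hs t ht) ⟨t₀, ht₀⟩
      have e2 : h / (2 * (((j + 1 : ℕ) : ℝ) * (2 * h))) = 1 / (4 * (j + 1)) := by
        push_cast; field_simp; ring
      rw [e2] at hPg
      refine le_trans (mul_le_mul_right (measure_mono fun t ht => ht.1) _)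
        (hPg.trans (measure_mono fun t ht => ?_))
      obtain ⟨z, hz, htz⟩ := hPI t ht
      have hord := hK.ordConnected_fiber y
      have ht₁ : t₀ + 2 * h ∈ {t | (t, y) ∈ K} := hord.out ht₀ ht₀' ⟨by linarith, by nlinarith⟩
      refine ⟨⟨⟨⟨(t₀ - t) / h, ?_, ?_⟩, ?_⟩, fun hc => Set.disjoint_left.1 hPd ht hc⟩, hy⟩
      · have : t + (t₀ - t) / h * h = t₀ := by field_simp; ring
        simpa [this] using ht₀
      · have : t + ((t₀ - t) / h + 2) * h = t₀ + 2 * h := by field_simp; ring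
        simpa [this] using ht₁
      · simpa using OrdConnected.add_mem_or_sub_mem hord ht₀ ht₁ hz htz
    · have : (fun t : ℝ => (t, y)) ⁻¹' (K ∩ Prod.snd ⁻¹' L) = ∅ := by
        ext t
        simp [hy]
      simp [this]
  rw [e1]
  have := ENNReal.toReal_mono (measure_ne_top _ _) key
  rwa [ENNReal.toReal_mul, ENNReal.toReal_ofReal (by positivity)] at this

theorem measureReal_le_spread (hν : PrekopaLeindler ν) (hKo : IsOpen K) (hK : Convex ℝ K)
    (hKm : 4 / 5 ≤ ((gaussianReal 0 1).prod ν).real K) {k : ℕ}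
    (hk : 8 ≤ ∑ j ∈ Finset.Icc 1 k, 1 / ((j : ℝ) + 1)) {h : ℝ} (hh : 0 < h)
    (hh' : 2 * (k + 1) * h ≤ 1) :
    ((gaussianReal 0 1).prod ν).real K ≤
      ((gaussianReal 0 1).prod ν).real (spread K ((h, 0) : ℝ × F)) := by
  set γ := (gaussianReal 0 1).prod ν with hγ
  have hml : ∀ r, MeasurableSet (Prod.snd ⁻¹' longFibers K r : Set (ℝ × F)) := fun r =>
    measurable_snd (hKo.longFibers r).measurableSet
  set G : ℕ → Set (ℝ × F) := fun j => (spread K ((h, 0) : ℝ × F) \ K) ∩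
    Prod.snd ⁻¹' (longFibers K (j * (2 * h)) \ longFibers K ((j + 1 : ℕ) * (2 * h))) with hG
  have hGm : ∀ j, MeasurableSet (G j) := fun j =>
    ((hKo.spread _).measurableSet.diff hKo.measurableSet).inter ((hml _).diff (hml _))
  have hGd : ∀ i j, i < j → Disjoint (G i) (G j) := by
    intro i j hij
    rw [Set.disjoint_left]
    intro x hx hx'
    refine hx.2.2 (longFibers_anti hK (by positivity) ?_ hx'.2.1)
    have : ((i + 1 : ℕ) : ℝ) ≤ j := by exact_mod_cast hij
    nlinarith
  have hsum : γ.real (⋃ j ∈ Finset.Icc 1 k, G j) = ∑ j ∈ Finset.Icc 1 k, γ.real (G j) := by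
    refine measureReal_biUnion_finset ?_ fun j _ => hGm j
    intro i _ j _ hij
    rcases lt_or_gt_of_ne hij with h1 | h1
    · exact hGd i j h1
    · exact (hGd j i h1).symm
  have hbase : longMass ν K (2 * h) + γ.real (⋃ j ∈ Finset.Icc 1 k, G j) ≤
      γ.real (spread K ((h, 0) : ℝ × F)) := by
    rw [longMass, ← measureReal_union (μ := γ) _ (Finset.measurableSet_biUnion _ fun j _ => hGm j)
      (measure_ne_top _ _) (measure_ne_top _ _)]
    · refine measureReal_mono (Set.union_subset (inter_longFibers_subset_spread hK hh) ?_)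
      exact Set.iUnion₂_subset fun j _ => (Set.inter_subset_left).trans Set.sdiff_subset
    · rw [Set.disjoint_left]
      intro x hx hx'
      obtain ⟨j, -, hj⟩ := Set.mem_iUnion₂.1 hx'
      exact hj.1.2 hx.1
  have hlayer : ∀ j ∈ Finset.Icc 1 k, 1 / ((j : ℝ) + 1) *
      ((longMass ν K 0 - longMass ν K (2 * h)) / 8) ≤ γ.real (G j) := by
    intro j hj
    rw [Finset.mem_Icc] at hj
    have hjk : (j : ℝ) ≤ k := by exact_mod_cast hj.2
    have hj0 : (0 : ℝ) ≤ j := by positivity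
    refine le_trans ?_ (spread_layer_ge hKo hK hh hj.1 (by nlinarith))
    have := longMass_layer_le hν hKo hK hKm (r := 2 * h) (by positivity) (j := j) (by nlinarith)
    calc _ = 1 / (4 * ((j : ℝ) + 1)) * ((longMass ν K 0 - longMass ν K (2 * h)) / 2) := by
          field_simp; ring
      _ ≤ _ := mul_le_mul_of_nonneg_left this (by positivity)
  have hs := Finset.sum_le_sum hlayer
  rw [← Finset.sum_mul, ← hsum] at hs
  have hd : 0 ≤ longMass ν K 0 - longMass ν K (2 * h) :=
    sub_nonneg.2 (longMass_anti hK le_rfl (by positivity))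
  rw [hγ, ← longMass_zero, ← hγ]
  nlinarith

end Fibers

theorem Convex.mem_spread_iff {E : Type*} [AddCommGroup E] [Module ℝ E] {K : Set E}
    (hK : Convex ℝ K) {u x : E} : x ∈ spread K u ↔
      (∃ τ : ℝ, x + τ • u ∈ K ∧ x + (τ + 2) • u ∈ K) ∧ ∃ σ : ℝ, |σ| ≤ 1 ∧ x + σ • u ∈ K := by
  refine and_congr_right ?_
  rintro ⟨τ, h1, h2⟩
  constructor
  · rintro (h | h)
    · exact ⟨1, by simp, by simpa using h⟩
    · exact ⟨-1, by simp, by simpa [sub_eq_add_neg] using h⟩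
  · rintro ⟨σ, hσ, h⟩
    have hI : Convex ℝ {t : ℝ | x + t • u ∈ K} := by
      intro s hs t ht a b ha hb hab
      have := hK hs ht ha hb hab
      have e : a • (x + s • u) + b • (x + t • u) = (a + b) • x + (a • s + b • t) • u := by
        simp only [smul_eq_mul]
        module
      rw [e, hab, one_smul] at this
      exact this
    have := OrdConnected.add_mem_or_sub_mem hI.ordConnected (a := τ) (h := 1) (t := 0) (z := σ) h1
      (by simpa using h2) h (by simpa using hσ)
    simpa [sub_eq_add_neg] using this

theorem Convex.spread {E : Type*} [AddCommGroup E] [Module ℝ E] {K : Set E} (hK : Convex ℝ K)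
    (u : E) : Convex ℝ (spread K u) := by
  intro x hx y hy a b ha hb hab
  rw [hK.mem_spread_iff] at hx hy ⊢
  obtain ⟨⟨s, h1, h2⟩, s', hs', h3⟩ := hx
  obtain ⟨⟨t, h4, h5⟩, t', ht', h6⟩ := hy
  obtain rfl : b = 1 - a := by linarith
  refine ⟨⟨a * s + (1 - a) * t, ?_, ?_⟩, a * s' + (1 - a) * t', ?_, ?_⟩
  · convert hK h1 h4 ha hb hab using 1
    module
  · convert hK h2 h5 ha hb hab using 1
    module
  · rw [abs_le] at *
    constructor <;> nlinarith
  · convert hK h3 h6 ha hb hab using 1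
    module

theorem preimage_spread {E F : Type*} [AddCommGroup E] [Module ℝ E] [AddCommGroup F] [Module ℝ F]
    (T : F →ₗ[ℝ] E) (K : Set E) (u : F) : T ⁻¹' spread K (T u) = spread (T ⁻¹' K) u := by
  ext x
  simp [spread]

section StdGaussian

variable {E : Type*} [NormedAddCommGroup E] [InnerProductSpace ℝ E] [FiniteDimensional ℝ E]
  [MeasurableSpace E] [BorelSpace E]

theorem exists_linearMap_map_eq_stdGaussian {u : E} (hu : u ≠ 0) :
    ∃ (n : ℕ) (T : ℝ × (Fin n → ℝ) →ₗ[ℝ] E), T (‖u‖, 0) = u ∧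
      ((gaussianReal 0 1).prod (Measure.pi fun _ : Fin n => gaussianReal 0 1)).map T =
        stdGaussian E := by
  have hpos : 0 < Module.finrank ℝ E := Module.finrank_pos_iff_exists_ne_zero.2 ⟨u, hu⟩
  obtain ⟨n, hn⟩ := Nat.exists_eq_succ_of_ne_zero hpos.ne'
  have hv : Orthonormal ℝ (({0} : Set (Fin (n + 1))).domRestrict fun _ => ‖u‖⁻¹ • u) := by
    refine ⟨fun i => ?_, fun i j hij => (hij (Subsingleton.elim i j)).elim⟩
    simp [norm_smul, hu]
  obtain ⟨b, hb⟩ := hv.exists_orthonormalBasis_extension_of_card_eq (by simpa using hn)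
  have hb0 : b 0 = ‖u‖⁻¹ • u := hb 0 rfl
  refine ⟨n, Fintype.linearCombination ℝ b ∘ₗ
    (Fin.consLinearEquiv ℝ (fun _ : Fin (n + 1) => ℝ)).toLinearMap, ?_, ?_⟩
  · simp [Fintype.linearCombination_apply, Fin.sum_univ_succ, hb0, smul_smul, hu]
  · have e' := (measurePreserving_piFinSuccAbove (fun _ : Fin (n + 1) => gaussianReal 0 1) 0).symm
    have hcons : ⇑(MeasurableEquiv.piFinSuccAbove (fun _ : Fin (n + 1) => ℝ) 0).symm
        = (Fin.consLinearEquiv ℝ (fun _ : Fin (n + 1) => ℝ)).toLinearMap := by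
      ext z i
      exact congrFun (Fin.insertNth_zero' z.1 z.2) i
    rw [stdGaussian_eq_map_pi_orthonormalBasis b, ← e'.map_eq, hcons, Measure.map_map
      (by fun_prop) (hcons ▸ e'.measurable), LinearMap.coe_comp]
    rfl

theorem exists_measureReal_le_spread_stdGaussian : ∃ h₀ : ℝ, 0 < h₀ ∧
    ∀ (E : Type) [NormedAddCommGroup E] [InnerProductSpace ℝ E] [FiniteDimensional ℝ E]
      [MeasurableSpace E] [BorelSpace E] (K : Set E) (u : E), IsOpen K → Convex ℝ K →
      4 / 5 ≤ (stdGaussian E).real K → ‖u‖ ≤ h₀ →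
      (stdGaussian E).real K ≤ (stdGaussian E).real (spread K u) := by
  obtain ⟨k, hk⟩ : ∃ k : ℕ, 8 ≤ ∑ j ∈ Finset.Icc 1 k, 1 / ((j : ℝ) + 1) := by
    obtain ⟨k, hk⟩ := (Real.tendsto_sum_range_one_div_nat_succ_atTop.eventually_ge_atTop 9).exists
    refine ⟨k, ?_⟩
    have : Finset.range k ⊆ insert 0 (Finset.Icc 1 k) := by
      intro i hi
      simp only [Finset.mem_range, Finset.mem_insert, Finset.mem_Icc] at *
      omega
    have h2 := Finset.sum_le_sum_of_subset_of_nonneg (f := fun j : ℕ => 1 / ((j : ℝ) + 1)) this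
      fun _ _ _ => by positivity
    rw [Finset.sum_insert (by simp)] at h2
    norm_num at h2 hk ⊢
    linarith
  refine ⟨1 / (2 * (k + 1)), by positivity, ?_⟩
  intro E _ _ _ _ _ K u hKo hK hKm hu
  by_cases hu0 : u = 0
  · subst hu0
    refine measureReal_mono fun x hx => ?_
    simp [spread, hx]
  obtain ⟨n, T, hT, hmap⟩ := exists_linearMap_map_eq_stdGaussian hu0
  have hTc : Continuous T := T.continuous_of_finiteDimensional
  have hreal : ∀ S : Set E, IsOpen S → (stdGaussian E).real S =
      ((gaussianReal 0 1).prod (Measure.pi fun _ : Fin n => gaussianReal 0 1)).real (T ⁻¹' S) := by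
    intro S hS
    rw [← hmap, map_measureReal_apply hTc.measurable hS.measurableSet]
  rw [hreal K hKo] at hKm
  rw [hreal K hKo, hreal _ (hKo.spread u), ← hT, preimage_spread]
  refine measureReal_le_spread (prekopaLeindler_pi_gaussianReal n) (hKo.preimage hTc)
    (hK.linear_preimage T) hKm hk (norm_pos_iff.2 hu0) ?_
  rw [le_div_iff₀ (by positivity)] at hu
  linarith

end StdGaussian

section Gaussian

variable {E : Type*} [NormedAddCommGroup E] [InnerProductSpace ℝ E] [FiniteDimensional ℝ E]
  [MeasurableSpace E] [BorelSpace E]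

theorem stdGaussian_real_neg {K : Set E} (hK : MeasurableSet K) :
    (stdGaussian E).real (-K) = (stdGaussian E).real K := by
  have h := stdGaussian_map (LinearIsometryEquiv.neg ℝ : E ≃ₗᵢ[ℝ] E)
  conv_rhs => rw [← h]
  rw [map_measureReal_apply (LinearIsometryEquiv.continuous _).measurable hK]
  rfl

theorem zero_mem_of_half_lt_stdGaussian {K : Set E} (hKo : IsOpen K) (hK : Convex ℝ K)
    (h : 1 / 2 < (stdGaussian E).real K) : (0 : E) ∈ K := by
  obtain ⟨x, hx, hx'⟩ : (K ∩ -K).Nonempty := by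
    by_contra hne
    have hd : Disjoint K (-K) := Set.disjoint_iff_inter_eq_empty.2 (Set.not_nonempty_iff_eq_empty.1 hne)
    have h1 := measureReal_union (μ := stdGaussian E) hd hKo.neg.measurableSet
      (measure_ne_top _ _) (measure_ne_top _ _)
    rw [stdGaussian_real_neg hKo.measurableSet] at h1
    have := measureReal_le_one (μ := stdGaussian E) (s := K ∪ -K)
    linarith
  have := hK hx hx' (a := 1 / 2) (b := 1 / 2) (by norm_num) (by norm_num) (by norm_num)
  simpa using this

/-- Iterating Banaszczyk's operation keeps all the partial sums inside `K`. -/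
theorem exists_subset_forall_partial_sum_mem {h₀ δ : ℝ} (hδ : 0 ≤ δ)
    (hs : ∀ (K : Set E) (u : E), IsOpen K → Convex ℝ K → 4 / 5 ≤ (stdGaussian E).real K →
      ‖u‖ ≤ h₀ → (stdGaussian E).real K ≤ (stdGaussian E).real (spread K u))
    {K : Set E} (hKo : IsOpen K) (hK : Convex ℝ K) (hKm : 1 - δ ≤ (stdGaussian E).real K)
    (n : ℕ) (v : ℕ → E) (hv : ∀ i, ‖v i‖ ≤ h₀) (hn : (n + 1) * δ ≤ 1 / 5) :
    ∃ L : Set E, IsOpen L ∧ Convex ℝ L ∧ 1 - (n + 1) * δ ≤ (stdGaussian E).real L ∧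
      ∀ x ∈ L, ∃ ε : ℕ → ℝ, (∀ i, ε i = 1 ∨ ε i = -1) ∧
        ∀ m ≤ n, x + ∑ i ∈ Finset.range m, ε i • v i ∈ K := by
  induction n generalizing v with
  | zero =>
    refine ⟨K, hKo, hK, by simpa using hKm, fun x hx => ⟨fun _ => 1, by simp, fun m hm => ?_⟩⟩
    obtain rfl : m = 0 := by omega
    simpa using hx
  | succ n ih =>
    push_cast at hn ⊢
    obtain ⟨L, hLo, hL, hLm, H⟩ := ih (fun i => v (i + 1)) (fun i => hv _) (by linarith)
    have hsp := hs L (v 0) hLo hL (by linarith) (hv 0)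
    refine ⟨spread L (v 0) ∩ K, (hLo.spread _).inter hKo, (hL.spread _).inter hK, ?_, ?_⟩
    · have h1 := measureReal_union_add_inter (μ := stdGaussian E) (s := spread L (v 0))
        hKo.measurableSet
      have := measureReal_le_one (μ := stdGaussian E) (s := spread L (v 0) ∪ K)
      linarith
    · rintro x ⟨⟨-, hx⟩, hxK⟩
      obtain ⟨s, hs, hxs⟩ : ∃ s : ℝ, (s = 1 ∨ s = -1) ∧ x + s • v 0 ∈ L := by
        rcases hx with hx | hx
        · exact ⟨1, by simp, by simpa using hx⟩
        · exact ⟨-1, by simp, by simpa [sub_eq_add_neg] using hx⟩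
      obtain ⟨ε, hε, hp⟩ := H _ hxs
      refine ⟨fun i => Nat.casesOn i s ε, fun i => ?_, fun m hm => ?_⟩
      · cases i with
        | zero => exact hs
        | succ i => exact hε i
      · cases m with
        | zero => simpa using hxK
        | succ m =>
          rw [Finset.sum_range_succ', add_comm (Finset.sum _ _), ← add_assoc]
          exact hp m (by omega)

theorem hasSubgaussianMGF_inner_stdGaussian (u : E) (hu : ‖u‖ ≤ 1) :
    HasSubgaussianMGF (fun x => ⟪u, x⟫) 1 (stdGaussian E) := by
  have h := IsGaussian.map_eq_gaussianReal (μ := stdGaussian E) (innerSL ℝ u)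
  rw [integral_strongDual_stdGaussian, variance_dual_stdGaussian, innerSL_apply_norm] at h
  change (stdGaussian E).map (fun x => ⟪u, x⟫) = _ at h
  constructor
  · intro t
    have := integrable_exp_mul_gaussianReal (μ := 0) (v := (‖u‖ ^ 2).toNNReal) t
    rw [← h, integrable_map_measure (by fun_prop) (by fun_prop)] at this
    exact this
  · intro t
    rw [mgf_gaussianReal h, Real.exp_le_exp, Real.coe_toNNReal _ (by positivity)]
    have : ‖u‖ ^ 2 ≤ 1 := pow_le_one₀ (norm_nonneg _) hu
    simp only [zero_mul, zero_add, NNReal.coe_one]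
    gcongr

theorem stdGaussian_real_inner_ge_le (u : E) (hu : ‖u‖ ≤ 1) {ρ : ℝ} (hρ : 0 ≤ ρ) :
    (stdGaussian E).real {x | ρ ≤ |⟪u, x⟫|} ≤ 2 * Real.exp (-ρ ^ 2 / 2) := by
  have h := hasSubgaussianMGF_inner_stdGaussian u hu
  have h1 := h.measure_ge_le hρ
  have h2 := h.neg.measure_ge_le hρ
  have : {x : E | ρ ≤ |⟪u, x⟫|} ⊆ {x | ρ ≤ ⟪u, x⟫} ∪ {x | ρ ≤ (-fun x => ⟪u, x⟫) x} := by
    intro x hx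
    exact le_abs.1 (show ρ ≤ |⟪u, x⟫| from hx)
  refine (measureReal_mono this).trans ((measureReal_union_le _ _).trans ?_)
  simp only [NNReal.coe_one, mul_one] at h1 h2
  linarith

/-- The intersection of finitely many symmetric slabs of large width has large Gaussian measure. -/
theorem one_sub_le_stdGaussian_iInter_slab {J : Type*} [Fintype J] (u : J → E)
    (hu : ∀ j, ‖u j‖ ≤ 1) {ρ : ℝ} (hρ : 0 ≤ ρ) :
    1 - 2 * Fintype.card J * Real.exp (-ρ ^ 2 / 2) ≤
      (stdGaussian E).real (⋂ j, {x | |⟪u j, x⟫| < ρ}) := by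
  have hm : MeasurableSet (⋂ j, {x : E | |⟪u j, x⟫| < ρ}) :=
    MeasurableSet.iInter fun j => measurableSet_lt (by fun_prop) measurable_const
  have h1 := probReal_compl_eq_one_sub (μ := stdGaussian E) hm
  have h2 : (⋂ j, {x : E | |⟪u j, x⟫| < ρ})ᶜ = ⋃ j, {x | ρ ≤ |⟪u j, x⟫|} := by
    ext x
    simp
  have h3 := measureReal_iUnion_fintype_le (μ := stdGaussian E) fun j => {x : E | ρ ≤ |⟪u j, x⟫|}
  have h4 := Finset.sum_le_sum fun j (_ : j ∈ Finset.univ) =>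
    stdGaussian_real_inner_ge_le (u j) (hu j) hρ
  rw [Finset.sum_const, Finset.card_univ, nsmul_eq_mul] at h4
  rw [h2] at h1
  linarith

end Gaussian

/-- Banaszczyk's theorem on balancing all the partial sums, for symmetric polytopes. -/
theorem exists_signs_abs_inner_partial_sum_lt : ∃ h₀ : ℝ, 0 < h₀ ∧
    ∀ (E : Type) [NormedAddCommGroup E] [InnerProductSpace ℝ E] [FiniteDimensional ℝ E]
      (J : Type) [Fintype J] (u : J → E) (_ : ∀ j, ‖u j‖ ≤ 1) (n : ℕ) (v : ℕ → E)
      (_ : ∀ i, ‖v i‖ ≤ h₀) (ρ : ℝ) (_ : 0 ≤ ρ)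
      (_ : 10 * (n + 1) * Fintype.card J * Real.exp (-ρ ^ 2 / 2) ≤ 1),
      ∃ ε : ℕ → ℝ, (∀ i, ε i = 1 ∨ ε i = -1) ∧
        ∀ m ≤ n, ∀ j, |∑ i ∈ Finset.range m, ε i * ⟪u j, v i⟫| < ρ := by
  obtain ⟨h₀, hh₀, hs⟩ := exists_measureReal_le_spread_stdGaussian
  refine ⟨h₀, hh₀, ?_⟩
  intro E _ _ _ J _ u hu n v hv ρ hρ hn
  borelize E
  have hKm := one_sub_le_stdGaussian_iInter_slab u hu hρ
  have hKo : IsOpen (⋂ j, {x | |⟪u j, x⟫| < ρ}) :=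
    isOpen_iInter_of_finite fun j => isOpen_lt (by fun_prop) continuous_const
  have hK : Convex ℝ (⋂ j, {x | |⟪u j, x⟫| < ρ}) := by
    refine convex_iInter fun j => ?_
    have := (convex_Ioo (-ρ) ρ).linear_preimage (innerSL ℝ (u j)).toLinearMap
    have e : {x : E | |⟪u j, x⟫| < ρ} = ⇑(innerSL ℝ (u j)).toLinearMap ⁻¹' Set.Ioo (-ρ) ρ := by
      ext x
      simp [abs_lt]
    rwa [e]
  obtain ⟨L, hLo, hL, hLm, H⟩ := exists_subset_forall_partial_sum_mem (h₀ := h₀) (by positivity)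
    (fun K u => hs E K u) hKo hK hKm n v hv (by linarith)
  obtain ⟨ε, hε, hp⟩ := H 0 (zero_mem_of_half_lt_stdGaussian hLo hL (by linarith))
  refine ⟨ε, hε, fun m hm j => ?_⟩
  have := Set.mem_iInter.1 (hp m hm) j
  simpa [inner_sum, inner_smul_right] using this

/-- The indicator of the dyadic intervals in the canonical decomposition of `{0, …, k - 1}`: at
level `ℓ` the decomposition uses at most the interval number `k / 2 ^ ℓ - 1`. -/
def dyadicDecomp (k : ℕ) {L M : ℕ} (r : Fin L × Fin M) : ℝ :=
  if k / 2 ^ (r.1 : ℕ) = r.2 + 1 ∧ Odd (k / 2 ^ (r.1 : ℕ)) then 1 else 0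

/-- The indicator of the dyadic intervals containing `i`. -/
def dyadicCell (i : ℕ) {L M : ℕ} (r : Fin L × Fin M) : ℝ :=
  if i / 2 ^ (r.1 : ℕ) = r.2 then 1 else 0

theorem sum_range_dyadic (L k i : ℕ) (hk : k < 2 ^ L) :
    ∑ l ∈ Finset.range L, (if k / 2 ^ l = i / 2 ^ l + 1 ∧ Odd (k / 2 ^ l) then (1 : ℝ) else 0) =
      if i < k then 1 else 0 := by
  induction L generalizing k i with
  | zero => simp at hk; simp [hk]
  | succ L ih =>
    rw [Finset.sum_range_succ']
    have h := ih (k / 2) (i / 2) (by rw [pow_succ] at hk; omega)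
    simp only [Nat.div_div_eq_div_mul, ← pow_succ'] at h
    rw [h]
    simp only [pow_zero, Nat.div_one, Nat.odd_iff]
    split_ifs <;> first | omega | norm_num

theorem sum_fin_ite_eq {M : ℕ} (a : ℕ) (ha : a < M) (f : ℕ → ℝ) :
    ∑ q : Fin M, (if a = q then f q else 0) = f a := by
  rw [Fin.sum_univ_eq_sum_range (fun q => if a = q then f q else 0)]
  simp [ha]

theorem sum_dyadicDecomp_mul_dyadicCell {L M k i : ℕ} (hk : k < 2 ^ L) (hi : i < M) :
    ∑ r : Fin L × Fin M, dyadicDecomp k r * dyadicCell i r = if i < k then 1 else 0 := by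
  rw [← sum_range_dyadic L k i hk, Fintype.sum_prod_type, Finset.sum_range]
  refine Finset.sum_congr rfl fun l _ => ?_
  simp only [dyadicDecomp, dyadicCell, mul_ite, mul_one, mul_zero]
  rw [sum_fin_ite_eq (i / 2 ^ (l : ℕ)) ((Nat.div_le_self _ _).trans_lt hi)
    (fun q => if k / 2 ^ (l : ℕ) = q + 1 ∧ Odd (k / 2 ^ (l : ℕ)) then 1 else 0)]

theorem sum_fin_ite_sq_le_one {M : ℕ} (p : Fin M → Prop) [DecidablePred p]
    (hp : ∀ q r, p q → p r → q = r) : ∑ q : Fin M, (if p q then (1 : ℝ) else 0) ^ 2 ≤ 1 := by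
  simp only [ite_pow, one_pow, ne_eq, OfNat.ofNat_ne_zero, not_false_eq_true, zero_pow,
    Finset.sum_boole]
  have : (Finset.univ.filter p).card ≤ 1 := by
    rw [Finset.card_le_one]
    intro a ha b hb
    exact hp a b (by simpa using ha) (by simpa using hb)
  exact_mod_cast this

theorem sum_sq_dyadicDecomp_le {L M : ℕ} (k : ℕ) :
    ∑ r : Fin L × Fin M, dyadicDecomp k r ^ 2 ≤ L := by
  rw [Fintype.sum_prod_type]
  refine (Finset.sum_le_sum fun l _ => sum_fin_ite_sq_le_one _ ?_).trans (by simp)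
  intro q r hq hr
  ext
  have h1 : k / 2 ^ (l : ℕ) = q + 1 := hq.1
  have h2 : k / 2 ^ (l : ℕ) = r + 1 := hr.1
  omega

theorem sum_sq_dyadicCell_le {L M : ℕ} (i : ℕ) :
    ∑ r : Fin L × Fin M, dyadicCell i r ^ 2 ≤ L := by
  rw [Fintype.sum_prod_type]
  refine (Finset.sum_le_sum fun l _ => sum_fin_ite_sq_le_one _ ?_).trans (by simp)
  intro q r hq hr
  ext
  exact hq.symm.trans hr

section Tensor

variable {ι κ : Type*} [Fintype ι] [Fintype κ] [DecidableEq ι]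

/-- The tensor product of a family of vectors. -/
noncomputable def tensorVec (f : ι → κ → ℝ) : EuclideanSpace ℝ (ι → κ) :=
  WithLp.toLp 2 fun s => ∏ j, f j (s j)

theorem inner_tensorVec (f g : ι → κ → ℝ) :
    ⟪tensorVec f, tensorVec g⟫ = ∏ j, ∑ r, f j r * g j r := by
  classical
  rw [Finset.prod_univ_sum, Fintype.piFinset_univ, PiLp.inner_apply]
  refine Finset.sum_congr rfl fun s _ => ?_
  simp [tensorVec, Finset.prod_mul_distrib, mul_comm]

theorem norm_sq_tensorVec_le (f : ι → κ → ℝ) {B : ℝ} (hf : ∀ j, ∑ r, f j r ^ 2 ≤ B) :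
    ‖tensorVec f‖ ^ 2 ≤ B ^ Fintype.card ι := by
  rw [← real_inner_self_eq_norm_sq, inner_tensorVec, ← Finset.card_univ, ← Finset.prod_const]
  refine Finset.prod_le_prod (fun j _ => Finset.sum_nonneg fun r _ => mul_self_nonneg _)
    fun j _ => ?_
  simpa [← sq] using hf j

end Tensor

theorem twenty_mul_two_pow_mul_exp_le {n L a : ℕ} (hL : 1 ≤ L) (hn : n ≤ 2 ^ (L * (a + 1))) :
    10 * ((n : ℝ) + 1) * ((2 ^ L) ^ a : ℕ) * Real.exp (-(√(4 * a + 8) * √L) ^ 2 / 2) ≤ 1 := by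
  have h1 : (n : ℝ) + 1 ≤ 2 * 2 ^ (L * (a + 1)) := by
    have : (n : ℝ) ≤ 2 ^ (L * (a + 1)) := by exact_mod_cast hn
    have := one_le_pow₀ (M₀ := ℝ) one_le_two (n := L * (a + 1))
    linarith
  have h2 : (2 : ℝ) ≤ Real.exp 1 := by have := Real.add_one_le_exp 1; linarith
  have h2L : (1 : ℝ) ≤ L := by exact_mod_cast hL
  have h20 : (20 : ℝ) ≤ Real.exp L ^ 3 := by
    have h3 : (2.718 : ℝ) ≤ Real.exp L :=
      (by linarith [Real.exp_one_gt_d9] : (2.718 : ℝ) ≤ Real.exp 1).trans (Real.exp_le_exp.2 h2L)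
    exact (by norm_num : (20 : ℝ) ≤ 2.718 ^ 3).trans (pow_le_pow_left₀ (by norm_num) h3 3)
  have h3 : ((2 : ℝ) ^ (L * (a + 1))) * (2 ^ L) ^ a ≤ Real.exp L ^ (2 * a + 1) := by
    have : (2 : ℝ) ^ L ≤ Real.exp L := by
      rw [← Real.exp_one_pow]
      gcongr
    calc _ = ((2 : ℝ) ^ L) ^ (2 * a + 1) := by ring
      _ ≤ _ := by gcongr
  have h4 : Real.exp (-(√(4 * a + 8) * √L) ^ 2 / 2) = (Real.exp L ^ (2 * a + 4))⁻¹ := by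
    rw [mul_pow, Real.sq_sqrt (by positivity), Real.sq_sqrt (by positivity), ← Real.exp_nat_mul,
      ← Real.exp_neg]
    congr 1
    push_cast
    ring
  rw [h4, ← div_eq_mul_inv, div_le_one (by positivity)]
  push_cast
  calc 10 * ((n : ℝ) + 1) * (2 ^ L) ^ a ≤ 10 * (2 * 2 ^ (L * (a + 1))) * (2 ^ L) ^ a := by gcongr
    _ = 20 * (2 ^ (L * (a + 1)) * (2 ^ L) ^ a) := by ring
    _ ≤ Real.exp L ^ 3 * Real.exp L ^ (2 * a + 1) := by gcongr
    _ = _ := by ring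

theorem exists_signs_partial_sum_box (d : ℕ) : ∃ C : ℝ, 0 < C ∧
    ∀ L n : ℕ, 1 ≤ L → n ≤ 2 ^ (L * (d + 1)) → ∀ p : ℕ → Fin d → ℕ, (∀ i j, p i j < 2 ^ L) →
      ∃ ε : ℕ → ℝ, (∀ i, ε i = 1 ∨ ε i = -1) ∧
        ∀ m ≤ n, ∀ k : Fin d → ℕ, (∀ j, k j < 2 ^ L) →
          |∑ i ∈ Finset.range m, ε i * (if ∀ j, p i j < k j then 1 else 0)| ≤
            C * (L ^ d * √L) := by
  obtain ⟨h₀, hh₀, H⟩ := exists_signs_abs_inner_partial_sum_lt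
  refine ⟨√(4 * d + 8) / h₀, by positivity, ?_⟩
  intro L n hL hn p hp
  have hL0 : (0 : ℝ) < L := by exact_mod_cast hL
  set u : (Fin d → Fin (2 ^ L)) → EuclideanSpace ℝ (Fin d → Fin L × Fin (2 ^ L)) :=
    fun k => (√(L ^ d))⁻¹ • tensorVec fun j => dyadicDecomp (k j) with hu
  set v : ℕ → EuclideanSpace ℝ (Fin d → Fin L × Fin (2 ^ L)) :=
    fun i => (h₀ * (√(L ^ d))⁻¹) • tensorVec fun j => dyadicCell (p i j) with hv
  have hnorm : ∀ f : Fin d → Fin L × Fin (2 ^ L) → ℝ, (∀ j, ∑ r, f j r ^ 2 ≤ L) →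
      (√(L ^ d))⁻¹ * ‖tensorVec f‖ ≤ 1 := by
    intro f hf
    have := norm_sq_tensorVec_le f hf
    rw [Fintype.card_fin] at this
    rw [inv_mul_le_one₀ (by positivity)]
    exact Real.le_sqrt_of_sq_le this
  have hinner : ∀ k i, ⟪u k, v i⟫ = h₀ / L ^ d * if ∀ j, p i j < k j then 1 else 0 := by
    intro k i
    rw [hu, hv, real_inner_smul_left, real_inner_smul_right, inner_tensorVec]
    simp_rw [sum_dyadicDecomp_mul_dyadicCell (k _).2 (hp i _)]
    have h1 : (√((L : ℝ) ^ d))⁻¹ * (√(L ^ d))⁻¹ = (L ^ d : ℝ)⁻¹ := by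
      rw [← mul_inv, Real.mul_self_sqrt (by positivity)]
    rw [Finset.prod_ite_zero, Finset.prod_const_one]
    simp only [Finset.mem_univ, true_imp_iff]
    rw [div_eq_mul_inv, ← h1]
    ring
  obtain ⟨ε, hε, hb⟩ := H _ _ u (fun k => by
      rw [hu, norm_smul, norm_inv, Real.norm_of_nonneg (Real.sqrt_nonneg _)]
      exact hnorm _ fun j => sum_sq_dyadicDecomp_le _) n v (fun i => by
      rw [hv, norm_smul, norm_mul, norm_inv, Real.norm_of_nonneg (Real.sqrt_nonneg _),
        Real.norm_of_nonneg hh₀.le, mul_assoc]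
      exact mul_le_of_le_one_right hh₀.le (hnorm _ fun j => sum_sq_dyadicCell_le _))
      (√(4 * d + 8) * √L) (by positivity) (by
      have := twenty_mul_two_pow_mul_exp_le hL hn
      simpa using this)
  refine ⟨ε, hε, fun m hm k hk => ?_⟩
  have h := (hb m hm fun j => ⟨k j, hk j⟩).le
  simp_rw [hinner] at h
  have e : ∑ i ∈ Finset.range m, ε i * (h₀ / L ^ d * if ∀ j, p i j < k j then 1 else 0) =
      h₀ / L ^ d * ∑ i ∈ Finset.range m, ε i * (if ∀ j, p i j < k j then 1 else 0) := by
    rw [Finset.mul_sum]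
    refine Finset.sum_congr rfl fun i _ => ?_
    ring
  rw [e, abs_mul, abs_of_pos (by positivity)] at h
  calc _ = (L ^ d / h₀) * (h₀ / L ^ d *
        |∑ i ∈ Finset.range m, ε i * (if ∀ j, p i j < k j then 1 else 0)|) := by field_simp
    _ ≤ (L ^ d / h₀) * (√(4 * d + 8) * √L) := by gcongr
    _ = _ := by ring

/-- A finite set can be enumerated in increasing order of a given function. -/
theorem exists_enum_monotone {α : Type*} (Q : Finset α) (g : α → ℕ) (a₀ : α) :
    ∃ p : ℕ → α, (∀ i < Q.card, p i ∈ Q) ∧ (∀ i, Q.card ≤ i → p i = a₀) ∧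
      (∀ i j, i ≤ j → j < Q.card → g (p i) ≤ g (p j)) ∧
      Set.InjOn p (Set.Iio Q.card) ∧
      ∀ f : α → ℝ, ∑ q ∈ Q, f q = ∑ i ∈ Finset.range Q.card, f (p i) := by
  set e := Q.equivFin.symm
  set σ := Tuple.sort fun i => g (e i)
  have hσ : Monotone ((fun i => g (e i)) ∘ σ) := Tuple.monotone_sort _
  have hp : ∀ i (h : i < Q.card), (if h : i < Q.card then (e (σ ⟨i, h⟩) : α) else a₀) =
    e (σ ⟨i, h⟩) := fun i h => dif_pos h
  refine ⟨fun i => if h : i < Q.card then (e (σ ⟨i, h⟩) : α) else a₀, fun i h => ?_,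
    fun i h => dif_neg (not_lt.2 h), fun i j hij hj => ?_, fun i hi j hj hij => ?_, fun f => ?_⟩
  · simp only [hp i h, Finset.coe_mem]
  · simp only [hp i (hij.trans_lt hj), hp j hj]
    exact hσ (show (⟨i, _⟩ : Fin Q.card) ≤ ⟨j, _⟩ from hij)
  · simp only [hp i hi, hp j hj] at hij
    exact Fin.mk.inj (σ.injective (e.injective (Subtype.ext hij)))
  · rw [Finset.sum_range, ← Finset.sum_coe_sort Q]
    refine (Fintype.sum_equiv (σ.trans e) _ _ fun i => ?_).symm
    simp

theorem exists_signs_box (d : ℕ) : ∃ C : ℝ, 0 < C ∧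
    ∀ L : ℕ, 1 ≤ L → ∀ Q : Finset (Fin (d + 1) → ℕ), (∀ q ∈ Q, ∀ j, q j < 2 ^ L) →
      ∃ ε : (Fin (d + 1) → ℕ) → ℤ, (∀ q, ε q = 1 ∨ ε q = -1) ∧
        ∀ k : Fin (d + 1) → ℕ, (∀ j, k j < 2 ^ L) →
          |∑ q ∈ Q with ∀ j, q j < k j, (ε q : ℝ)| ≤ C * (L ^ d * √L) := by
  obtain ⟨C, hC, H⟩ := exists_signs_partial_sum_box d
  refine ⟨C, hC, fun L hL Q hQ => ?_⟩
  have hcard : Q.card ≤ 2 ^ (L * (d + 1)) := by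
    have : Q ⊆ Fintype.piFinset fun _ => Finset.range (2 ^ L) := fun q hq => by
      simpa using hQ q hq
    simpa [pow_mul] using Finset.card_le_card this
  obtain ⟨p, hpQ, hp0, hmono, hinj, hsum⟩ := exists_enum_monotone Q (fun q => q 0) 0
  obtain ⟨ε, hε, hb⟩ := H L Q.card hL hcard (fun i j => p i j.succ) (fun i j => by
    by_cases hi : i < Q.card
    · exact hQ _ (hpQ i hi) _
    · simp [hp0 i (not_lt.1 hi)])
  obtain ⟨ε', hε'⟩ : ∃ ε' : (Fin (d + 1) → ℕ) → ℤ, (∀ q, ε' q = 1 ∨ ε' q = -1) ∧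
      ∀ i < Q.card, (ε' (p i) : ℝ) = ε i := by
    classical
    refine ⟨fun q => if ∃ i < Q.card, p i = q ∧ ε i = 1 then 1 else -1, fun q => ?_,
      fun i hi => ?_⟩
    · dsimp only
      split_ifs <;> simp
    · dsimp only
      split_ifs with h
      · obtain ⟨j, hj, hij, h1⟩ := h
        rw [← hinj hj hi hij, h1]
        simp
      · push Not at h
        rw [(hε i).resolve_left (h i hi rfl)]
        simp
  refine ⟨ε', hε'.1, fun k hk => ?_⟩
  obtain ⟨m, hm, hmk⟩ : ∃ m ≤ Q.card, ∀ i < Q.card, (p i 0 < k 0 ↔ i < m) := by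
    by_cases h : ∃ i, i < Q.card ∧ k 0 ≤ p i 0
    · classical
      refine ⟨Nat.find h, (Nat.find_spec h).1.le, fun i hi => ⟨fun h1 => ?_, fun h1 => ?_⟩⟩
      · by_contra! hc
        have := (Nat.find_spec h).2.trans (hmono _ _ hc hi)
        omega
      · have := Nat.find_min h h1
        push Not at this
        exact this hi
    · push Not at h
      exact ⟨Q.card, le_rfl, fun i hi => by simp [h i hi, hi]⟩
  convert hb m hm (fun j => k j.succ) fun j => hk _ using 2
  rw [Finset.sum_filter, hsum]
  have hsub : Finset.range m ⊆ Finset.range Q.card := Finset.range_subset_range.2 hm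
  rw [← Finset.sum_subset hsub]
  · refine Finset.sum_congr rfl fun i hi => ?_
    rw [Finset.mem_range] at hi
    simp [Fin.forall_fin_succ, hε'.2 i (hi.trans_le hm), (hmk i (hi.trans_le hm)).2 hi]
  · intro i hi hi'
    rw [Finset.mem_range] at hi hi'
    rw [if_neg]
    intro hc
    exact hi' ((hmk i hi).1 (hc 0))

section Rounding

variable {ι κ : Type*} {Q : Finset ι} {B : κ → ι → Prop} [∀ k, DecidablePred (B k)] {D : ℝ}

/-- Rounding dyadic rationals by repeatedly rounding off the last binary digit. -/
theorem exists_round_dyadic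
    (hD : ∀ Q' ⊆ Q, ∃ ε : ι → ℤ, (∀ q, ε q = 1 ∨ ε q = -1) ∧
      ∀ k, |∑ q ∈ Q' with B k q, (ε q : ℝ)| ≤ D) (K : ℕ) (a : ι → ℤ) :
    ∃ n : ι → ℤ, (∀ c ∈ Q, |n c * 2 ^ K - a c| ≤ 2 ^ K - 1) ∧
      ∀ k, |∑ c ∈ Q with B k c, ((n c : ℝ) * 2 ^ K - a c)| ≤ D * (2 ^ K - 1) := by
  induction K generalizing a with
  | zero => exact ⟨a, by simp, by simp⟩
  | succ K ih =>
    obtain ⟨ε, hε, hb⟩ := hD (Q.filter fun c => Odd (a c)) (Finset.filter_subset _ _)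
    have ha : ∀ c, ∃ b : ℤ, 2 * b - a c = if Odd (a c) then ε c else 0 := by
      intro c
      split_ifs with h
      · obtain ⟨b, hb⟩ := h
        rcases hε c with h1 | h1
        · exact ⟨b + 1, by rw [h1]; omega⟩
        · exact ⟨b, by rw [h1]; omega⟩
      · obtain ⟨b, hb⟩ := Int.not_odd_iff_even.1 h
        exact ⟨b, by omega⟩
    choose b hab using ha
    obtain ⟨n, hn, hn'⟩ := ih b
    refine ⟨n, fun c hc => ?_, fun k => ?_⟩
    · have h1 := hn c hc
      have h2 : |2 * b c - a c| ≤ 1 := by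
        rw [hab]
        rcases hε c with h | h <;> split_ifs <;> simp [h]
      rw [abs_le] at *
      rw [pow_succ]
      constructor <;> linarith
    · have e : ∑ c ∈ Q with B k c, ((n c : ℝ) * 2 ^ (K + 1) - a c) =
          2 * (∑ c ∈ Q with B k c, ((n c : ℝ) * 2 ^ K - b c)) +
            ∑ c ∈ Q.filter (fun c => Odd (a c)) with B k c, (ε c : ℝ) := by
        rw [Finset.filter_comm, Finset.sum_filter (fun c => Odd (a c)), Finset.mul_sum,
          ← Finset.sum_add_distrib]
        refine Finset.sum_congr rfl fun c _ => ?_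
        have : (2 * b c - a c : ℝ) = if Odd (a c) then (ε c : ℝ) else 0 := by
          exact_mod_cast hab c
        rw [← this]
        ring
      rw [e]
      have h1 := hn' k
      have h2 := hb k
      rw [abs_le] at *
      rw [pow_succ]
      constructor <;> linarith

/-- Rounding nonnegative weights with small errors on all the sets of a family, given a bound for
the combinatorial discrepancy of the family. -/
theorem exists_round
    (hD : ∀ Q' ⊆ Q, ∃ ε : ι → ℤ, (∀ q, ε q = 1 ∨ ε q = -1) ∧
      ∀ k, |∑ q ∈ Q' with B k q, (ε q : ℝ)| ≤ D) (hD0 : 0 ≤ D) (w : ι → ℝ) (hw : ∀ c, 0 ≤ w c) :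
    ∃ n : ι → ℕ, (∀ c ∈ Q, w c = 0 → n c = 0) ∧
      ∀ k, |∑ c ∈ Q with B k c, ((n c : ℝ) - w c)| ≤ D + 1 := by
  obtain ⟨K, hK⟩ : ∃ K : ℕ, Q.card ≤ 2 ^ K := ⟨Q.card, Nat.lt_two_pow_self.le⟩
  have hK' : (Q.card : ℝ) ≤ 2 ^ K := by exact_mod_cast hK
  have hpos : (0 : ℝ) < 2 ^ K := by positivity
  obtain ⟨n, hn, hb⟩ := exists_round_dyadic hD K fun c => ⌊w c * 2 ^ K⌋
  have hfl : ∀ c, 0 ≤ ⌊w c * 2 ^ K⌋ := fun c => Int.floor_nonneg.2 (mul_nonneg (hw c) hpos.le)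
  have hn0 : ∀ c ∈ Q, 0 ≤ n c := by
    intro c hc
    by_contra! h
    have h1 := (abs_le.1 (hn c hc)).1
    have := hfl c
    have h3 : n c * 2 ^ K ≤ -1 * 2 ^ K := mul_le_mul_of_nonneg_right (by omega) (by positivity)
    omega
  refine ⟨fun c => (n c).toNat, fun c hc h0 => ?_, fun k => ?_⟩
  · have h1 := (abs_le.1 (hn c hc)).2
    simp only [h0, zero_mul, Int.floor_zero, sub_zero] at h1
    by_contra! h
    have h3 : 1 * 2 ^ K ≤ n c * 2 ^ K := mul_le_mul_of_nonneg_right (by omega) (by positivity)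
    omega
  · have e : ∑ c ∈ Q with B k c, (((n c).toNat : ℝ) - w c) =
        ((∑ c ∈ Q with B k c, ((n c : ℝ) * 2 ^ K - ⌊w c * 2 ^ K⌋)) -
          ∑ c ∈ Q with B k c, Int.fract (w c * 2 ^ K)) / 2 ^ K := by
      rw [← Finset.sum_sub_distrib, Finset.sum_div]
      refine Finset.sum_congr rfl fun c hc => ?_
      have : (((n c).toNat : ℤ) : ℝ) = n c := by
        rw [Int.toNat_of_nonneg (hn0 c (Finset.mem_filter.1 hc).1)]
      rw [Int.cast_natCast] at this
      rw [this, sub_sub, Int.floor_add_fract]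
      field_simp
    have h1 := hb k
    have h2 : ∑ c ∈ Q with B k c, Int.fract (w c * 2 ^ K) ≤ 2 ^ K := by
      refine (Finset.sum_le_card_nsmul _ _ 1 fun c _ => (Int.fract_lt_one _).le).trans ?_
      rw [nsmul_eq_mul, mul_one]
      exact le_trans (by exact_mod_cast Finset.card_filter_le _ _) hK'
    have h3 : 0 ≤ ∑ c ∈ Q with B k c, Int.fract (w c * 2 ^ K) :=
      Finset.sum_nonneg fun c _ => Int.fract_nonneg _
    rw [e, abs_div, abs_of_pos hpos, div_le_iff₀ hpos]
    rw [abs_le] at *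
    constructor <;> nlinarith

end Rounding

/-- A set with at least two points has measure at most `r` as soon as all the compact intervals with
end points in it do. -/
theorem measureReal_le_of_forall_Icc_le {ν : Measure ℝ} [IsProbabilityMeasure ν] {C : Set ℝ}
    (hC : MeasurableSet C) {r : ℝ} (hr : 0 ≤ r)
    (h : ∀ s ∈ C, ∀ t ∈ C, s < t → ν.real (Set.Icc s t) ≤ r) (hn : C.Nontrivial) :
    ν.real C ≤ r := by
  by_contra! hc
  have h1 : ENNReal.ofReal r < ν C := by
    rw [← ofReal_measureReal (measure_ne_top _ _)]
    exact (ENNReal.ofReal_lt_ofReal_iff (hr.trans_lt hc)).2 hc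
  obtain ⟨K, hKC, hK, hrK⟩ := hC.exists_lt_isCompact h1
  have hKne : K.Nonempty := by
    rw [Set.nonempty_iff_ne_empty]
    rintro rfl
    simp at hrK
  have hs := hK.sInf_mem hKne
  have ht := hK.sSup_mem hKne
  have hsub : K ⊆ Set.Icc (sInf K) (sSup K) := fun x hx =>
    ⟨csInf_le hK.bddBelow hx, le_csSup hK.bddAbove hx⟩
  obtain ⟨s, hsC, t, htC, hst, hsub'⟩ : ∃ s ∈ C, ∃ t ∈ C, s < t ∧ K ⊆ Set.Icc s t := by
    obtain ⟨y, hy, hne⟩ := hn.exists_ne (sInf K)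
    rcases lt_or_gt_of_ne hne with h1 | h1
    · exact ⟨y, hy, sSup K, hKC ht, h1.trans_le (hsub hs).2,
        hsub.trans (Set.Icc_subset_Icc_left h1.le)⟩
    · exact ⟨sInf K, hKC hs, max y (sSup K), by rcases max_cases y (sSup K) with h | h <;>
        simp [h, hy, hKC ht], lt_max_of_lt_left h1,
        hsub.trans (Set.Icc_subset_Icc_right (le_max_right _ _))⟩
  have h2 := measure_mono (μ := ν) hsub'
  have h3 := h s hsC t htC hst
  rw [measureReal_def] at h3
  have h4 := ENNReal.toReal_mono (measure_ne_top _ _) h2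
  have h5 := (ENNReal.ofReal_lt_iff_lt_toReal hr (measure_ne_top _ _)).1 hrK
  linarith

/-- The line splits into `2 * m + 1` intervals such that every initial half-line is sandwiched
between two initial unions of these intervals, with difference of mass at most `2 / m`. -/
theorem exists_quantile_index (ν : Measure ℝ) [IsProbabilityMeasure ν] {m : ℕ} (hm : 0 < m) :
    ∃ I : ℝ → ℕ, Measurable I ∧ (∀ t, I t < 2 * m + 1) ∧
      ∀ a, ∃ k₁ k₂, k₁ ≤ 2 * m + 1 ∧ k₂ ≤ 2 * m + 1 ∧ {t | I t < k₁} ⊆ Set.Iic a ∧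
        Set.Iic a ⊆ {t | I t < k₂} ∧ ν.real ({t | I t < k₂} \ {t | I t < k₁}) ≤ 2 / m := by
  have hm' : (0 : ℝ) < m := by exact_mod_cast hm
  set f : ℝ → ℕ := fun t => ⌊m * ν.real (Set.Iic t)⌋₊ with hf
  set g : ℝ → ℕ := fun t => ⌊m * ν.real (Set.Iio t)⌋₊ with hg
  have hfm : Monotone f := fun s t hst => Nat.floor_mono
    (mul_le_mul_of_nonneg_left (measureReal_mono (Set.Iic_subset_Iic.2 hst)) hm'.le)
  have hgm : Monotone g := fun s t hst => Nat.floor_mono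
    (mul_le_mul_of_nonneg_left (measureReal_mono (Set.Iio_subset_Iio hst)) hm'.le)
  have hle : ∀ A : Set ℝ, ⌊m * ν.real A⌋₊ ≤ m := fun A =>
    Nat.floor_le_of_le (mul_le_of_le_one_right hm'.le measureReal_le_one)
  have hmono : Monotone (f + g) := hfm.add hgm
  have hIm : Measurable (f + g) := hmono.measurable
  have hlt : ∀ t, (f + g) t < 2 * m + 1 := fun t => by
    have := hle (Set.Iic t)
    have := hle (Set.Iio t)
    simp only [Pi.add_apply, hf, hg]
    omega
  refine ⟨f + g, hIm, hlt, fun a => ?_⟩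
  have hsub : Set.Iic a ⊆ {t | (f + g) t < (f + g) a + 1} := fun t ht =>
    Nat.lt_succ_of_le (hmono ht)
  by_cases hn : {t | (f + g) t = (f + g) a}.Nontrivial
  · refine ⟨(f + g) a, (f + g) a + 1, (hlt a).le, hlt a, fun t ht => ?_, hsub, ?_⟩
    · exact (hmono.reflect_lt ht).le
    · have e : {t | (f + g) t < (f + g) a + 1} \ {t | (f + g) t < (f + g) a} =
          {t | (f + g) t = (f + g) a} := by
        ext t
        simp only [Set.mem_sdiff, Set.mem_ofPred_eq]
        omega
      rw [e]
      refine measureReal_le_of_forall_Icc_le (measurableSet_eq_fun hIm measurable_const)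
        (by positivity) (fun s hs t ht hst => ?_) hn
      have h1 := hfm hst.le
      have h2 := hgm hst.le
      have h3 : (f + g) s = (f + g) t := Eq.trans hs (Eq.symm ht)
      simp only [Pi.add_apply] at h3
      have h4 : f s = f t := by omega
      have h5 : g s = g t := by omega
      have key : ∀ x y : ℝ, 0 ≤ x → ⌊m * x⌋₊ = ⌊m * y⌋₊ → y - x ≤ 1 / m := by
        intro x y hx hxy
        have h6 := Nat.lt_floor_add_one (m * y)
        have h7 := Nat.floor_le (mul_nonneg hm'.le hx)
        rw [← hxy] at h6
        rw [le_div_iff₀ hm']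
        linarith
      have h6 := key _ _ measureReal_nonneg h4
      have h7 := key _ _ measureReal_nonneg h5
      have h8 : ν.real (Set.Iic s) ≤ ν.real (Set.Iio t) :=
        measureReal_mono (Set.Iic_subset_Iio.2 hst)
      have h9 : ν.real (Set.Iic t) = ν.real (Set.Iio s) + ν.real (Set.Icc s t) := by
        rw [← measureReal_union _ measurableSet_Icc (measure_ne_top _ _) (measure_ne_top _ _),
          Set.Iio_union_Icc_eq_Iic hst.le]
        rw [Set.disjoint_left]
        exact fun x hx hx' => absurd hx'.1 (not_le.2 hx)
      have : (2 : ℝ) / m = 1 / m + 1 / m := by ring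
      linarith
  · refine ⟨(f + g) a + 1, (f + g) a + 1, hlt a, hlt a, fun t ht => ?_, hsub, ?_⟩
    · by_contra hc
      refine hn ⟨t, ?_, a, rfl, fun h => hc h.le⟩
      have : (f + g) a ≤ (f + g) t := hmono (not_le.1 hc).le
      have ht' : (f + g) t < (f + g) a + 1 := ht
      exact le_antisymm (Nat.lt_succ_iff.1 ht') this
    · simp only [Set.sdiff_self, measureReal_empty]
      positivity

/-- A list of points with prescribed multiplicities. -/
theorem exists_enum_multiplicity {ι X : Type*} (Q : Finset ι) (n : ι → ℕ) (z : ι → X) (S : Set X)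
    (hz : ∀ c ∈ Q, z c ∈ S) (hS : S.Nonempty) :
    ∃ y : ℕ → X, (∀ i, y i ∈ S) ∧
      ∀ f : X → ℝ, ∑ i ∈ Finset.range (∑ c ∈ Q, n c), f (y i) = ∑ c ∈ Q, n c * f (z c) := by
  classical
  induction Q using Finset.induction_on with
  | empty =>
    obtain ⟨s, hs⟩ := hS
    exact ⟨fun _ => s, fun _ => hs, by simp⟩
  | insert c Q hc ih =>
    obtain ⟨y, hyS, hy⟩ := ih fun c hc => hz c (Finset.mem_insert_of_mem hc)
    refine ⟨fun i => if i < n c then z c else y (i - n c), fun i => ?_, fun f => ?_⟩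
    · dsimp only
      split_ifs
      · exact hz c (Finset.mem_insert_self _ _)
      · exact hyS _
    · rw [Finset.sum_insert hc, Finset.sum_insert hc, Finset.sum_range_add, ← hy f]
      have h1 : ∑ i ∈ Finset.range (n c), f (if i < n c then z c else y (i - n c)) =
          n c * f (z c) := by
        rw [Finset.sum_congr rfl (g := fun _ => f (z c)) fun i hi => by simp [Finset.mem_range.1 hi]]
        simp
      simp [h1]

theorem abs_sum_range_sub_sum_range_le (f : ℕ → ℝ) (h0 : ∀ i, 0 ≤ f i) (h1 : ∀ i, f i ≤ 1)
    (T N : ℕ) :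
    |∑ i ∈ Finset.range T, f i - ∑ i ∈ Finset.range N, f i| ≤ |(T : ℝ) - N| := by
  wlog h : N ≤ T generalizing T N
  · rw [abs_sub_comm, abs_sub_comm (T : ℝ)]
    exact this N T (le_of_not_ge h)
  obtain ⟨t, rfl⟩ := Nat.exists_eq_add_of_le h
  rw [Finset.sum_range_add, add_sub_cancel_left, Nat.cast_add, add_sub_cancel_left,
    abs_of_nonneg (Finset.sum_nonneg fun i _ => h0 _), Nat.abs_cast]
  refine (Finset.sum_le_card_nsmul _ _ 1 fun i _ => h1 _).trans ?_
  simp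

/-- Transference: a bound for the combinatorial discrepancy of anchored boxes in a grid gives points
whose discrepancy with respect to a given measure is small. -/
theorem exists_points_of_signs {d N m : ℕ} (hm : 0 < m) (hdm : d * N ≤ m) {D : ℝ} (hD0 : 0 ≤ D)
    (hD : ∀ Q ⊆ Fintype.piFinset fun _ : Fin d => Finset.range (2 * m + 1),
      ∃ ε : (Fin d → ℕ) → ℤ, (∀ q, ε q = 1 ∨ ε q = -1) ∧
        ∀ k : Fin d → ℕ, (∀ j, k j ≤ 2 * m + 1) →
          |∑ q ∈ Q with ∀ j, q j < k j, (ε q : ℝ)| ≤ D)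
    (μ : Measure (Fin d → ℝ)) [IsProbabilityMeasure μ] (hμ : μ (Set.Icc 0 1) = 1) :
    ∃ x : Fin N → Fin d → ℝ, (∀ n, x n ∈ Set.Icc (0 : Fin d → ℝ) 1) ∧
      ∀ a : Fin d → ℝ, |∑ n, (Set.Icc (0 : Fin d → ℝ) a).indicator (fun _ => (1 : ℝ)) (x n) -
        N * μ.real (Set.Icc 0 a)| ≤ 2 * D + 4 := by
  have hm' : (0 : ℝ) < m := by exact_mod_cast hm
  have hprob : ∀ j : Fin d, IsProbabilityMeasure (μ.map fun x => x j) := fun j =>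
    Measure.isProbabilityMeasure_map (measurable_pi_apply j).aemeasurable
  choose I hIm hI k₁ k₂ hk₁ hk₂ hsub₁ hsub₂ hdiff using fun j : Fin d =>
    exists_quantile_index (μ.map fun x => x j) hm
  set Φ : (Fin d → ℝ) → Fin d → ℕ := fun x j => I j (x j) with hΦ
  have hΦm : Measurable Φ := measurable_pi_lambda _ fun j => (hIm j).comp (measurable_pi_apply j)
  set Q := Fintype.piFinset fun _ : Fin d => Finset.range (2 * m + 1) with hQ
  have hΦQ : ∀ x, Φ x ∈ Q := fun x => by simp [hQ, hΦ, hI]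
  set P : (Fin d → ℕ) → Set (Fin d → ℝ) := fun k => {x | ∀ j, Φ x j < k j} with hP
  have hPm : ∀ k, MeasurableSet (P k) := fun k =>
    hΦm (MeasurableSet.of_discrete (s := {c : Fin d → ℕ | ∀ j, c j < k j}))
  set w : (Fin d → ℕ) → ℝ := fun c => N * μ.real (Φ ⁻¹' {c}) with hw
  have hwsum : ∀ k : Fin d → ℕ, ∑ c ∈ Q with ∀ j, c j < k j, w c = N * μ.real (P k) := by
    intro k
    rw [← Finset.mul_sum, sum_measureReal_preimage_singleton _ fun c _ => hΦm (.of_discrete)]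
    congr 2
    ext x
    simp [hP, hΦQ]
  obtain ⟨n, hn0, hn⟩ := exists_round (κ := {k : Fin d → ℕ // ∀ j, k j ≤ 2 * m + 1}) (Q := Q)
    (B := fun k c => ∀ j, c j < k.1 j) (D := D)
    (fun Q' hQ' => (hD Q' hQ').imp fun ε h => ⟨h.1, fun k => h.2 k.1 k.2⟩) hD0 w
    fun c => by positivity
  have hz : ∀ c, ∃ z ∈ Set.Icc (0 : Fin d → ℝ) 1, w c ≠ 0 → Φ z = c := by
    intro c
    by_cases h : ∃ z ∈ Set.Icc (0 : Fin d → ℝ) 1, Φ z = c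
    · obtain ⟨z, hz, hzc⟩ := h
      exact ⟨z, hz, fun _ => hzc⟩
    · refine ⟨0, by simp, fun hc => absurd ?_ hc⟩
      have hd : Disjoint (Φ ⁻¹' {c}) (Set.Icc (0 : Fin d → ℝ) 1) :=
        Set.disjoint_left.2 fun z hz hz' => h ⟨z, hz', hz⟩
      have h1 := measureReal_mono (μ := μ) hd.subset_compl_right
      rw [probReal_compl_eq_one_sub measurableSet_Icc, measureReal_def μ (Set.Icc 0 1), hμ] at h1
      have h2 : μ.real (Φ ⁻¹' {c}) = 0 := le_antisymm (by simpa using h1) measureReal_nonneg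
      simp [hw, h2]
  choose z hzI hzΦ using hz
  obtain ⟨y, hyI, hy⟩ := exists_enum_multiplicity Q n z (Set.Icc 0 1) (fun c _ => hzI c)
    ⟨0, by simp⟩
  refine ⟨fun i => y i, fun i => hyI i, fun a => ?_⟩
  set T := ∑ c ∈ Q, n c with hT
  set A : (Fin d → ℝ) → ℝ := (Set.Icc (0 : Fin d → ℝ) a).indicator fun _ => (1 : ℝ) with hA
  have hA0 : ∀ x, 0 ≤ A x := fun x => Set.indicator_nonneg (fun _ _ => zero_le_one) x
  have hA1 : ∀ x, A x ≤ 1 := fun x => Set.indicator_le_self' (fun _ _ => zero_le_one) x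
  have hTN : |(T : ℝ) - N| ≤ D + 1 := by
    have h1 := hn ⟨fun _ => 2 * m + 1, fun _ => le_rfl⟩
    have h2 : P (fun _ => 2 * m + 1) = Set.univ := by
      ext x
      simp [hP, hΦ, hI]
    rw [Finset.sum_sub_distrib, hwsum, h2, Finset.filter_true_of_mem] at h1
    · simpa [hT] using h1
    · intro c hc
      simpa [hQ] using hc
  have hTN' := (abs_sum_range_sub_sum_range_le (fun i => A (y i)) (fun i => hA0 _) (fun i => hA1 _)
    T N).trans hTN
  rw [hy A] at hTN'
  rw [Fin.sum_univ_eq_sum_range fun i => A (y i)]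
  set K₁ : Fin d → ℕ := fun j => k₁ j (a j) with hK₁
  set K₂ : Fin d → ℕ := fun j => k₂ j (a j) with hK₂
  have hcount : ∀ k : Fin d → ℕ, (∀ j, k j ≤ 2 * m + 1) →
      |∑ c ∈ Q, n c * (if ∀ j, c j < k j then (1 : ℝ) else 0) - N * μ.real (P k)| ≤ D + 1 := by
    intro k hk
    have h1 := hn ⟨k, hk⟩
    rw [Finset.sum_sub_distrib, hwsum] at h1
    simpa [Finset.sum_filter] using h1
  have hc₁ := hcount K₁ fun j => hk₁ j _
  have hc₂ := hcount K₂ fun j => hk₂ j _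
  have hzc : ∀ c ∈ Q, n c ≠ 0 → Φ (z c) = c := fun c hc h =>
    hzΦ c fun h0 => h (hn0 c hc h0)
  have hs₁ : ∑ c ∈ Q, n c * (if ∀ j, c j < K₁ j then (1 : ℝ) else 0) ≤ ∑ c ∈ Q, n c * A (z c) := by
    refine Finset.sum_le_sum fun c hc => ?_
    by_cases h0 : n c = 0
    · simp [h0]
    refine mul_le_mul_of_nonneg_left ?_ (Nat.cast_nonneg _)
    split_ifs with h
    · rw [hA, Set.indicator_of_mem]
      refine ⟨(hzI c).1, fun j => hsub₁ j (a j) ?_⟩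
      have := congrFun (hzc c hc h0) j
      have h2 := h j
      rw [← this] at h2
      exact h2
    · exact hA0 _
  have hs₂ : ∑ c ∈ Q, n c * A (z c) ≤ ∑ c ∈ Q, n c * (if ∀ j, c j < K₂ j then (1 : ℝ) else 0) := by
    refine Finset.sum_le_sum fun c hc => ?_
    by_cases h0 : n c = 0
    · simp [h0]
    refine mul_le_mul_of_nonneg_left ?_ (Nat.cast_nonneg _)
    split_ifs with h
    · exact hA1 _
    · rw [hA, Set.indicator_of_notMem]
      intro hmem
      refine h fun j => ?_
      have := congrFun (hzc c hc h0) j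
      rw [← this]
      exact hsub₂ j (a j) (hmem.2 j)
  have hμ₁ : μ.real (P K₁) ≤ μ.real (Set.Icc 0 a) := by
    have h1 : P K₁ ⊆ Set.Icc 0 a ∪ (Set.Icc (0 : Fin d → ℝ) 1)ᶜ := by
      intro x hx
      by_cases hx1 : x ∈ Set.Icc (0 : Fin d → ℝ) 1
      · exact Or.inl ⟨hx1.1, fun j => hsub₁ j (a j) (hx j)⟩
      · exact Or.inr hx1
    have h2 := (measureReal_mono (μ := μ) h1).trans (measureReal_union_le _ _)
    rw [probReal_compl_eq_one_sub measurableSet_Icc, measureReal_def μ (Set.Icc 0 1), hμ] at h2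
    simpa using h2
  have hμ₂ : μ.real (Set.Icc 0 a) ≤ μ.real (P K₂) :=
    measureReal_mono fun x hx j => hsub₂ j (a j) (hx.2 j)
  have hμ₁₂ : N * μ.real (P K₂) ≤ N * μ.real (P K₁) + 2 := by
    have h1 : P K₂ ⊆ P K₁ ∪ ⋃ j, (fun x : Fin d → ℝ => x j) ⁻¹'
        ({t | I j t < K₂ j} \ {t | I j t < K₁ j}) := by
      intro x hx
      by_cases hx1 : x ∈ P K₁
      · exact Or.inl hx1
      · have : ∃ j, ¬ Φ x j < K₁ j := not_forall.1 hx1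
        obtain ⟨j, hj⟩ := this
        exact Or.inr (Set.mem_iUnion.2 ⟨j, hx j, hj⟩)
    have h2 : ∀ j, μ.real ((fun x : Fin d → ℝ => x j) ⁻¹'
        ({t | I j t < K₂ j} \ {t | I j t < K₁ j})) ≤ 2 / m := by
      intro j
      have := hdiff j (a j)
      rwa [map_measureReal_apply (by fun_prop)] at this
      exact (measurableSet_lt (hIm j) measurable_const).diff
        (measurableSet_lt (hIm j) measurable_const)
    have h3 := (measureReal_mono (μ := μ) h1).trans (measureReal_union_le _ _)
    have h4 := h3.trans (add_le_add_right (measureReal_iUnion_fintype_le _) _)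
    have h5 := h4.trans (add_le_add_right (Finset.sum_le_sum fun j _ => h2 j) _)
    rw [Finset.sum_const, Finset.card_univ, Fintype.card_fin, nsmul_eq_mul] at h5
    have h6 : (d : ℝ) * N ≤ m := by exact_mod_cast hdm
    have h7 : (N : ℝ) * (d * (2 / m)) ≤ 2 := by
      have : (N : ℝ) * (d * (2 / m)) = 2 * (d * N / m) := by ring
      rw [this]
      have := (div_le_one hm').2 h6
      linarith
    calc _ ≤ (N : ℝ) * (μ.real (P K₁) + d * (2 / m)) := mul_le_mul_of_nonneg_left h5 (by positivity)
      _ ≤ _ := by rw [mul_add]; linarith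
  have hμ₁' := mul_le_mul_of_nonneg_left hμ₁ (Nat.cast_nonneg (α := ℝ) N)
  have hμ₂' := mul_le_mul_of_nonneg_left hμ₂ (Nat.cast_nonneg (α := ℝ) N)
  rw [abs_le] at *
  constructor <;> linarith

theorem two_mul_mul_add_one_lt_two_pow (d N : ℕ) (hN : 1 ≤ N) :
    2 * (d * N) + 1 < 2 ^ (2 * d + 2 + Nat.log 2 N) := by
  have h1 : N < 2 ^ (Nat.log 2 N + 1) := Nat.lt_pow_succ_log_self one_lt_two N
  have h2 : 2 * d + 1 < 2 ^ (2 * d + 1) := Nat.lt_two_pow_self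
  calc 2 * (d * N) + 1 < (2 * d + 2) * N := by nlinarith
    _ ≤ 2 ^ (2 * d + 1) * 2 ^ (Nat.log 2 N + 1) := Nat.mul_le_mul h2 h1.le
    _ = _ := by rw [← pow_add]; congr 1; ring

theorem cast_add_log_le (d N : ℕ) (hN : 2 ≤ N) :
    ((2 * d + 2 + Nat.log 2 N : ℕ) : ℝ) ≤ (4 * d + 6) * Real.log N := by
  have h2 : (0.5 : ℝ) ≤ Real.log 2 := by linarith [Real.log_two_gt_d9]
  have h1 : Real.log 2 ≤ Real.log N := Real.log_le_log two_pos (by exact_mod_cast hN)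
  have h3 : (Nat.log 2 N : ℝ) * Real.log 2 ≤ Real.log N := by
    rw [← Real.log_pow]
    exact Real.log_le_log (by positivity) (by exact_mod_cast Nat.pow_log_le_self 2 (by omega))
  have h4 : (0 : ℝ) ≤ Nat.log 2 N := Nat.cast_nonneg _
  have h5 : (0 : ℝ) ≤ d := Nat.cast_nonneg _
  push_cast
  nlinarith

/-- **Theorem 1** (main theorem): for every `d ≥ 1` there is a constant `c_d > 0` such
that for every `N ≥ 2` and every Borel probability measure `μ` on `[0,1]^d` there exist
points `x_1, …, x_N ∈ [0,1]^d` with star-discrepancy with respect to `μ` at most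
`c_d (log N)^(d - 1/2) / N`. -/
theorem exists_points_star_discrepancy_le (d : ℕ) (hd : 1 ≤ d) :
    ∃ c : ℝ, 0 < c ∧
      ∀ N : ℕ, 2 ≤ N →
        ∀ μ : Measure (Fin d → ℝ), IsProbabilityMeasure μ →
          μ (Set.Icc 0 1) = 1 →
          ∃ x : Fin N → (Fin d → ℝ),
            (∀ n, x n ∈ Set.Icc (0 : Fin d → ℝ) 1) ∧
            ∀ a : Fin d → ℝ, a ∈ Set.Icc (0 : Fin d → ℝ) 1 →
              |(1 / N : ℝ) * ∑ n, (Set.Icc (0 : Fin d → ℝ) a).indicator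
                    (fun _ => (1 : ℝ)) (x n)
                  - (μ (Set.Icc 0 a)).toReal|
                ≤ c * Real.log N ^ ((d : ℝ) - 1 / 2) / N := by
  obtain ⟨d, rfl⟩ := Nat.exists_eq_add_of_le' hd
  obtain ⟨C, hC, H⟩ := exists_signs_box d
  set s : ℝ := ((d + 1 : ℕ) : ℝ) - 1 / 2 with hs
  have hs0 : 0 ≤ s := by
    rw [hs]
    push_cast
    have : (0 : ℝ) ≤ d := Nat.cast_nonneg _
    linarith
  set R : ℝ := 4 * ((d + 1 : ℕ) : ℝ) + 6 with hR
  have hR0 : 0 < R := by positivity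
  refine ⟨(2 * C + 4) * R ^ s, by positivity, ?_⟩
  intro N hN μ _ hμ
  have hN0 : (0 : ℝ) < N := by positivity
  set L := 2 * (d + 1) + 2 + Nat.log 2 N with hL
  have hlt := two_mul_mul_add_one_lt_two_pow (d + 1) N (by omega)
  rw [← hL] at hlt
  obtain ⟨x, hx, hb⟩ := exists_points_of_signs (m := (d + 1) * N) (N := N) (by positivity) le_rfl
    (D := C * (L ^ d * √L)) (by positivity) (fun Q hQ => by
      obtain ⟨ε, hε, h⟩ := H L (by omega) Q fun q hq j => by
        have := Fintype.mem_piFinset.1 (hQ hq) j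
        rw [Finset.mem_range] at this
        omega
      exact ⟨ε, hε, fun k hk => h k fun j => (hk j).trans_lt hlt⟩) μ hμ
  refine ⟨x, hx, fun a _ => ?_⟩
  have hL1 : (1 : ℝ) ≤ L := by
    have : 1 ≤ L := by omega
    exact_mod_cast this
  have hLs : (L : ℝ) ^ d * √L = (L : ℝ) ^ s := by
    rw [Real.sqrt_eq_rpow, ← Real.rpow_natCast, ← Real.rpow_add (by positivity), hs]
    congr 1
    push_cast
    ring
  have hLle : (L : ℝ) ^ s ≤ R ^ s * Real.log N ^ s := by
    rw [← Real.mul_rpow hR0.le (Real.log_natCast_nonneg N)]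
    exact Real.rpow_le_rpow (by positivity) (cast_add_log_le (d + 1) N hN) hs0
  have h1 : (1 : ℝ) ≤ (L : ℝ) ^ s := Real.one_le_rpow hL1 hs0
  have h := hb a
  rw [hLs] at h
  rw [le_div_iff₀ hN0]
  calc _ = |∑ n, (Set.Icc (0 : Fin (d + 1) → ℝ) a).indicator (fun _ => (1 : ℝ)) (x n) -
        N * μ.real (Set.Icc 0 a)| := by
        conv_lhs => rw [← abs_of_pos hN0]
        rw [← abs_mul, abs_of_pos hN0, sub_mul, measureReal_def]
        congr 1
        field_simp
    _ ≤ (2 * C + 4) * (L : ℝ) ^ s := h.trans (by linarith)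
    _ ≤ (2 * C + 4) * (R ^ s * Real.log N ^ s) := by gcongr
    _ = _ := by ring
end

section
/- (Halving step.) Let μ be a Borel probability measure on [0,1]^d, let 𝒢 be a class of Borel subsets of [0,1]^d with [0,1]^d ∈ 𝒢, and let M ≥ 1 be an integer. Let P_0 ⊂ [0,1]^d be a set of 2M points, and suppose there exists a coloring y : P_0 → {−1, +1} with sup_{G ∈ 𝒢} |∑_{p ∈ P_0 ∩ G} y(p)| ≤ h for some h ≥ 0. Then there exists a subset P_1 ⊆ P_0 of cardinality exactly M such that for every G ∈ 𝒢, |∑_{p ∈ P_1} 1_G(p) − M μ(G)| ≤ (1/2) D(P_0, 𝒢, μ) + h. -/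
open MeasureTheory

/-- A `±1` coloring with nonpositive total, on a set of `2 * M` points, yields a subset of `M` points
which halves every set `G` up to half the sum of the color discrepancies of `G` and of the whole
set. -/
theorem exists_halving_subset_of_sum_nonpos {α : Type*} (M : ℕ) (P : Finset α)
    (hP : P.card = 2 * M) (y : α → ℝ) (hy : ∀ p ∈ P, y p = 1 ∨ y p = -1)
    (hsum : ∑ p ∈ P, y p ≤ 0) :
    ∃ Q ⊆ P, Q.card = M ∧ ∀ G : Set α,
      |(∑ p ∈ Q, G.indicator (fun _ => (1 : ℝ)) p)
          - (∑ p ∈ P, G.indicator (fun _ => (1 : ℝ)) p) / 2|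
        ≤ (|∑ p ∈ P, G.indicator y p| + |∑ p ∈ P, y p|) / 2 := by
  classical
  have sum_filter_indicator (G : Set α) :
      ∑ p ∈ P with y p = 1, G.indicator (fun _ => (1 : ℝ)) p
        = ((∑ p ∈ P, G.indicator (fun _ => (1 : ℝ)) p) + ∑ p ∈ P, G.indicator y p) / 2 := by
    rw [Finset.sum_filter, ← Finset.sum_add_distrib, Finset.sum_div]
    refine Finset.sum_congr rfl fun p hp => ?_
    by_cases hG : p ∈ G <;> rcases hy p hp with h | h <;> norm_num [hG, h]
  have card_filter : ((P.filter (y · = 1)).card : ℝ) = M + (∑ p ∈ P, y p) / 2 := by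
    have h := sum_filter_indicator Set.univ
    simp only [Set.indicator_univ, Finset.sum_const, nsmul_eq_mul, mul_one, hP] at h
    push_cast at h
    linarith
  have card_le : (P.filter (y · = 1)).card ≤ M := by
    have : ((P.filter (y · = 1)).card : ℝ) ≤ M := by linarith
    exact_mod_cast this
  obtain ⟨Q, hAQ, hQP, hQ⟩ := Finset.exists_subsuperset_card_eq
    (Finset.filter_subset (y · = 1) P) card_le (by omega)
  refine ⟨Q, hQP, hQ, fun G => ?_⟩
  have hsplit := Finset.sum_sdiff (f := G.indicator fun _ => (1 : ℝ)) hAQ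
  have hnonneg : 0 ≤ ∑ p ∈ Q \ P.filter (y · = 1), G.indicator (fun _ => (1 : ℝ)) p :=
    Finset.sum_nonneg fun p _ => Set.indicator_nonneg (fun _ _ => zero_le_one) p
  have hle : ∑ p ∈ Q \ P.filter (y · = 1), G.indicator (fun _ => (1 : ℝ)) p
      ≤ (M : ℝ) - (P.filter (y · = 1)).card := by
    have hcard : ((Q \ P.filter (y · = 1)).card : ℝ) = M - (P.filter (y · = 1)).card := by
      rw [Finset.cast_card_sdiff hAQ, hQ]
    rw [← hcard, ← nsmul_one]
    exact Finset.sum_le_card_nsmul _ _ _ fun p _ =>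
      Set.indicator_le_self' (fun _ _ => zero_le_one) p
  rw [sum_filter_indicator G] at hsplit
  rw [abs_of_nonpos hsum, abs_le]
  constructor <;>
    linarith [neg_abs_le (∑ p ∈ P, G.indicator y p), le_abs_self (∑ p ∈ P, G.indicator y p)]

/-- The version of `exists_halving_subset_of_sum_nonpos` without a sign condition. -/
theorem exists_halving_subset {α : Type*} (M : ℕ) (P : Finset α)
    (hP : P.card = 2 * M) (y : α → ℝ) (hy : ∀ p ∈ P, y p = 1 ∨ y p = -1) :
    ∃ Q ⊆ P, Q.card = M ∧ ∀ G : Set α,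
      |(∑ p ∈ Q, G.indicator (fun _ => (1 : ℝ)) p)
          - (∑ p ∈ P, G.indicator (fun _ => (1 : ℝ)) p) / 2|
        ≤ (|∑ p ∈ P, G.indicator y p| + |∑ p ∈ P, y p|) / 2 := by
  rcases le_total (∑ p ∈ P, y p) 0 with hsum | hsum
  · exact exists_halving_subset_of_sum_nonpos M P hP y hy hsum
  · have hneg := exists_halving_subset_of_sum_nonpos M P hP (-y)
      (fun p hp => by rcases hy p hp with h | h <;> simp [h]) (by simpa using hsum)
    simpa only [Set.indicator_neg', Pi.neg_apply, Finset.sum_neg_distrib, abs_neg] using hneg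

/-- **Halving step** of the transference principle.  If `P₀ ⊆ [0,1]^d` has `2M` points
and admits a coloring `y : P₀ → {−1,+1}` with discrepancy at most `h` over `𝒢` (where
`[0,1]^d ∈ 𝒢`), then there is a subset `P₁ ⊆ P₀` of cardinality `M` such that for every
`G ∈ 𝒢` one has `|#(P₁ ∩ G) − M μ(G)| ≤ D(P₀, 𝒢, μ)/2 + h`; here `D` is any upper bound
for the discrepancy of `P₀`, i.e. `|#(P₀ ∩ G) − 2M μ(G)| ≤ D` for all `G ∈ 𝒢`. -/
theorem halving_step (d : ℕ) (hd : 1 ≤ d)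
    (μ : Measure (Fin d → ℝ)) (hμ : IsProbabilityMeasure μ)
    (hμcube : μ (Set.Icc 0 1) = 1)
    (𝒢 : Set (Set (Fin d → ℝ)))
    (h𝒢meas : ∀ G ∈ 𝒢, MeasurableSet G)
    (hcube : Set.Icc (0 : Fin d → ℝ) 1 ∈ 𝒢)
    (M : ℕ) (hM : 1 ≤ M)
    (P₀ : Finset (Fin d → ℝ)) (hP₀card : P₀.card = 2 * M)
    (hP₀sub : ↑P₀ ⊆ Set.Icc (0 : Fin d → ℝ) 1)
    (h : ℝ) (hh : 0 ≤ h)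
    (y : (Fin d → ℝ) → ℝ) (hy : ∀ p ∈ P₀, y p = 1 ∨ y p = -1)
    (hydisc : ∀ G ∈ 𝒢, |∑ p ∈ P₀, G.indicator y p| ≤ h)
    (D : ℝ)
    (hD : ∀ G ∈ 𝒢,
      |(∑ p ∈ P₀, G.indicator (fun _ => (1 : ℝ)) p) - (2 * M : ℝ) * (μ G).toReal| ≤ D) :
    ∃ P₁ : Finset (Fin d → ℝ), P₁ ⊆ P₀ ∧ P₁.card = M ∧
      ∀ G ∈ 𝒢,
        |(∑ p ∈ P₁, G.indicator (fun _ => (1 : ℝ)) p) - (M : ℝ) * (μ G).toReal|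
          ≤ D / 2 + h := by
  obtain ⟨P₁, hsub, hcard, hP₁⟩ := exists_halving_subset M P₀ hP₀card y hy
  refine ⟨P₁, hsub, hcard, fun G hG => ?_⟩
  have htotal : |∑ p ∈ P₀, y p| ≤ h := by
    rw [← Finset.sum_congr rfl fun p hp => Set.indicator_of_mem (hP₀sub hp) y]
    exact hydisc _ hcube
  have hhalf := abs_le.mp ((hP₁ G).trans (by linarith [hydisc G hG] : _ ≤ h))
  have hdisc := abs_le.mp (hD G hG)
  rw [abs_le]
  constructor <;> linarith
end
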